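/- arXiv:1407.4308 — 17 statements merged into one kernel-verified Lean document; each statement's English description precedes it below -/
import Mathlib

section
/- Let v ∈ ℝ^m be a vector with nonnegative entries that has no dominant entry. Then there exist real angles θ_1, …, θ_m such that ∑_{j=1}^m v_j · e^{iθ_j} = 0 (equivalently, there exist complex numbers z_1, …, z_m of modulus 1 with ∑_{j=1}^m v_j z_j = 0). -/
lemma aux_triangle (r a t : ℝ) (hr : 0 ≤ r) (ha : 0 ≤ a) (h1 : |r - a| ≤ t) (h2 : t ≤ r + a) :
    ∃ w : ℂ, ‖w‖ = 1 ∧ ‖(r : ℂ) - a * w‖ = t := by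
  have hc : ContinuousOn (fun θ : ℝ => ‖(r : ℂ) - a * Complex.exp (θ * Complex.I)‖)
      (Set.Icc 0 Real.pi) := by
    apply Continuous.continuousOn
    fun_prop
  have h := intermediate_value_Icc Real.pi_pos.le hc
  have e0 : ‖(r : ℂ) - a * Complex.exp (((0 : ℝ) : ℂ) * Complex.I)‖ = |r - a| := by
    rw [← Real.norm_eq_abs, ← Complex.norm_real]
    simp
  have e1 : ‖(r : ℂ) - a * Complex.exp ((Real.pi : ℂ) * Complex.I)‖ = r + a := by
    rw [← abs_of_nonneg (add_nonneg hr ha), ← Real.norm_eq_abs, ← Complex.norm_real]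
    simp
  obtain ⟨θ, -, hθ⟩ := h (show t ∈ Set.Icc _ _ from ⟨by rw [e0]; exact h1, by rw [e1]; exact h2⟩)
  exact ⟨_, Complex.norm_exp_ofReal_mul_I θ, hθ⟩

lemma aux_polygon {ι : Type*} [DecidableEq ι] (v : ι → ℝ) (hv : ∀ j, 0 ≤ v j) (s : Finset ι) :
    ∀ r : ℝ, 0 ≤ r → r ≤ ∑ j ∈ s, v j → (∀ k ∈ s, 2 * v k ≤ r + ∑ j ∈ s, v j) →
    ∃ z : ι → ℂ, (∀ j, ‖z j‖ = 1) ∧ ∑ j ∈ s, (v j : ℂ) * z j = r := by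
  induction s using Finset.induction_on with
  | empty =>
    intro r h0 h1 _
    have : r = 0 := le_antisymm (by simpa using h1) h0
    exact ⟨fun _ => 1, by simp, by simp [this]⟩
  | insert a s has ih =>
    intro r h0 h1 h2
    rw [Finset.sum_insert has] at h1 h2
    have hS : ∀ k ∈ s, v k ≤ ∑ j ∈ s, v j := fun k hk =>
      Finset.single_le_sum (fun j _ => hv j) hk
    have hS0 : 0 ≤ ∑ j ∈ s, v j := Finset.sum_nonneg (fun j _ => hv j)
    have ha := h2 a (Finset.mem_insert_self a s)
    have hva := hv a
    obtain ⟨w, hw, hw2⟩ := aux_triangle r (v a) (min (∑ j ∈ s, v j) (r + v a)) h0 hva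
      (le_min (abs_le.2 ⟨by linarith, by linarith⟩) (abs_le.2 ⟨by linarith, by linarith⟩))
      (min_le_right _ _)
    obtain ⟨z, hz, hz2⟩ := ih (min (∑ j ∈ s, v j) (r + v a)) (le_min hS0 (by linarith))
      (min_le_left _ _) (by
        intro k hk
        have h3 := hS k hk
        have h4 := h2 k (Finset.mem_insert_of_mem hk)
        rcases min_choice (∑ j ∈ s, v j) (r + v a) with h | h <;> rw [h] <;> linarith)
    have hp := Complex.norm_mul_exp_arg_mul_I ((r : ℂ) - v a * w)
    rw [hw2, ← hz2] at hp
    set u := Complex.exp (((r : ℂ) - v a * w).arg * Complex.I) with hu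
    have hu1 : ‖u‖ = 1 := Complex.norm_exp_ofReal_mul_I _
    refine ⟨fun j => if j = a then w else z j * u, ?_, ?_⟩
    · intro j
      by_cases h : j = a <;> simp [h, hw, hz, hu1]
    · rw [Finset.sum_insert has]
      have : ∑ j ∈ s, (v j : ℂ) * (if j = a then w else z j * u)
          = (∑ j ∈ s, (v j : ℂ) * z j) * u := by
        rw [Finset.sum_mul]
        refine Finset.sum_congr rfl fun j hj => ?_
        have : j ≠ a := fun h => has (h ▸ hj)
        simp [this, mul_assoc]
      simp only [this, hp, if_true]
      ring

/-- If a nonnegative vector `v ∈ ℝ^m` has no dominant entry (i.e. no entry `v k` with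
`|v k| > ∑_{j ≠ k} |v j|`), then there are complex numbers of modulus 1, `z j`, with
`∑ j, v j * z j = 0`. -/
theorem no_dominant_entry_exists_unit_combination_zero {m : ℕ}
    (v : Fin m → ℝ) (hv : ∀ j, 0 ≤ v j)
    (hnd : ∀ k, ¬ (∑ j ∈ Finset.univ.erase k, |v j|) < |v k|) :
    ∃ z : Fin m → ℂ, (∀ j, ‖z j‖ = 1) ∧ ∑ j, (v j : ℂ) * z j = 0 := by
  obtain ⟨z, hz, hz2⟩ := aux_polygon v hv Finset.univ 0 le_rfl
    (Finset.sum_nonneg fun j _ => hv j) (by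
      intro k _
      have h := hnd k
      simp only [abs_of_nonneg (hv _)] at h
      have h2 := Finset.add_sum_erase Finset.univ v (Finset.mem_univ k)
      linarith)
  exact ⟨z, hz, by simpa using hz2⟩
end

section
/- Let A be an m×n matrix with nonnegative real entries, and let A' be its entry-wise square root, i.e. A'(i,j) = √(A(i,j)). If every column of A' has no dominant entry, then prank(A) < m. -/
open scoped ComplexOrder

/-- The PSD-rank of a nonnegative real matrix: the smallest `r` such that there exist
`r × r` complex Hermitian positive semidefinite matrices `E i` and `F j` with
`A i j = Tr (E i * F j)` for all `i, j`. -/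
noncomputable def prank {α β : Type*} [Fintype α] [Fintype β] (A : Matrix α β ℝ) : ℕ :=
  sInf {r : ℕ |
    ∃ (E : α → Matrix (Fin r) (Fin r) ℂ) (F : β → Matrix (Fin r) (Fin r) ℂ),
      (∀ i, (E i).PosSemidef) ∧ (∀ j, (F j).PosSemidef) ∧
      ∀ i j, (A i j : ℂ) = ((E i) * (F j)).trace}

lemma tri_aux (s b t : ℝ) (hs : 0 ≤ s) (hb : 0 ≤ b) (ht : 0 ≤ t)
    (h1 : t ≤ s + b) (h2 : s ≤ t + b) (h3 : b ≤ s + t) :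
    ∃ w p : ℂ, ‖w‖ = 1 ∧ ‖p‖ = b ∧ w * (s : ℂ) + p = (t : ℂ) := by
  rcases hs.eq_or_lt with rfl | hs
  · have : b = t := by linarith
    subst this
    exact ⟨1, b, by simp, by simp [abs_of_nonneg hb], by simp⟩
  rcases ht.eq_or_lt with rfl | ht
  · have : b = s := by linarith
    subst this
    exact ⟨1, -b, by simp, by simp [abs_of_nonneg hb], by simp⟩
  obtain ⟨c, hc⟩ : ∃ c : ℝ, c = (s^2 + t^2 - b^2) / (2 * s * t) := ⟨_, rfl⟩
  have hst : 0 < 2 * s * t := by positivity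
  have hc' : c * (2 * s * t) = s^2 + t^2 - b^2 := by
    rw [hc]; field_simp
  have hc1 : c ≤ 1 := by
    rw [hc, div_le_one hst]; nlinarith
  have hc2 : -1 ≤ c := by
    rw [hc, le_div_iff₀ hst]; nlinarith
  have hd : 0 ≤ 1 - c^2 := by nlinarith
  have hsq := Real.mul_self_sqrt hd
  refine ⟨⟨c, Real.sqrt (1 - c^2)⟩, t - ⟨c, Real.sqrt (1 - c^2)⟩ * s, ?_, ?_, by ring⟩
  · rw [← sq_eq_sq₀ (norm_nonneg _) zero_le_one, Complex.sq_norm, Complex.normSq_apply]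
    simp only
    linarith
  · rw [← sq_eq_sq₀ (norm_nonneg _) hb, Complex.sq_norm, Complex.normSq_apply]
    simp
    linear_combination (s^2) * hsq - hc'

lemma poly_aux : ∀ (n : ℕ) (a : Fin n → ℝ) (t : ℝ), (∀ i, 0 ≤ a i) → 0 ≤ t →
    t ≤ ∑ i, a i → (∀ k, 2 * a k ≤ t + ∑ i, a i) →
    ∃ z : Fin n → ℂ, (∀ i, ‖z i‖ = a i) ∧ ∑ i, z i = (t : ℂ) := by
  intro n
  induction n with
  | zero =>
    intro a t _ h0 h1 _
    refine ⟨fun _ => 0, fun i => i.elim0, ?_⟩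
    have : t = 0 := le_antisymm (by simpa using h1) h0
    simp [this]
  | succ n ih =>
    intro a t ha h0 h1 h2
    rw [Fin.sum_univ_castSucc] at h1 h2
    have hb := ha (Fin.last n)
    have hl := h2 (Fin.last n)
    have hS : 0 ≤ ∑ i : Fin n, a i.castSucc := Finset.sum_nonneg fun i _ => ha _
    have hle : ∀ k : Fin n, a k.castSucc ≤ ∑ i : Fin n, a i.castSucc := fun k =>
      Finset.single_le_sum (f := fun i : Fin n => a i.castSucc) (fun i _ => ha _) (Finset.mem_univ k)
    obtain ⟨s, hs⟩ : ∃ s, s = min (t + a (Fin.last n)) (∑ i : Fin n, a i.castSucc) := ⟨_, rfl⟩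
    have hs1 : s ≤ t + a (Fin.last n) := hs ▸ min_le_left _ _
    have hs2 : s ≤ ∑ i : Fin n, a i.castSucc := hs ▸ min_le_right _ _
    have hs0 : 0 ≤ s := hs ▸ le_min (by linarith) hS
    obtain ⟨z, hz, hz'⟩ := ih (fun i => a i.castSucc) s (fun i => ha _) hs0 hs2 (by
      intro k
      have := h2 k.castSucc
      have := hle k
      rcases min_choice (t + a (Fin.last n)) (∑ i : Fin n, a i.castSucc) with h | h <;>
        rw [h] at hs <;> linarith)
    obtain ⟨w, p, hw, hp, hwp⟩ := tri_aux s (a (Fin.last n)) t hs0 hb h0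
      (by rcases min_choice (t + a (Fin.last n)) (∑ i : Fin n, a i.castSucc) with h | h <;>
            rw [h] at hs <;> linarith)
      hs1
      (by rcases min_choice (t + a (Fin.last n)) (∑ i : Fin n, a i.castSucc) with h | h <;>
            rw [h] at hs <;> linarith)
    refine ⟨Fin.snoc (fun i => w * z i) p, ?_, ?_⟩
    · intro i
      refine Fin.lastCases ?_ (fun i => ?_) i
      · simpa using hp
      · simp [hw, hz]
    · rw [Fin.sum_univ_castSucc]
      simp only [Fin.snoc_castSucc, Fin.snoc_last]
      rw [← Finset.mul_sum, hz', hwp]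

/-- If every column of the entry-wise square root of a nonnegative `m × n` matrix `A`
has no dominant entry, then `prank A < m`. -/
theorem prank_lt_of_no_dominant_entry {m n : ℕ} (hm : 0 < m)
    (A : Matrix (Fin m) (Fin n) ℝ) (hA : ∀ i j, 0 ≤ A i j)
    (hnd : ∀ (j : Fin n) (k : Fin m),
      ¬ (∑ i ∈ Finset.univ.erase k, Real.sqrt (A i j)) < Real.sqrt (A k j)) :
    prank A < m := by
  have key : ∀ j, ∃ z : Fin m → ℂ, (∀ i, ‖z i‖ = Real.sqrt (A i j)) ∧ ∑ i, z i = ((0 : ℝ) : ℂ) := by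
    intro j
    refine poly_aux m _ 0 (fun i => Real.sqrt_nonneg _) le_rfl
      (Finset.sum_nonneg fun i _ => Real.sqrt_nonneg _) fun k => ?_
    have h := not_lt.1 (hnd j k)
    have := Finset.add_sum_erase Finset.univ (fun i => Real.sqrt (A i j)) (Finset.mem_univ k)
    linarith
  choose z hz hz0 using key
  obtain ⟨r, rfl⟩ : ∃ r, m = r + 1 := ⟨m - 1, by omega⟩
  refine Nat.lt_succ_of_le (Nat.sInf_le ?_)
  let u : Fin (r + 1) → Fin r → ℂ := Fin.snoc (fun i => Pi.single i 1) (fun _ => 1)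
  let w : Fin n → Fin r → ℂ := fun j i => z j i.castSucc
  refine ⟨fun i => Matrix.vecMulVec (u i) (star (u i)), fun j => Matrix.vecMulVec (w j) (star (w j)),
    fun i => Matrix.posSemidef_vecMulVec_self_star _, fun j => Matrix.posSemidef_vecMulVec_self_star _, ?_⟩
  intro i j
  have hA' : (A i j : ℂ) = z j i * star (z j i) := by
    have : (A i j : ℂ) = ((‖z j i‖ ^ 2 : ℝ) : ℂ) := by rw [hz, Real.sq_sqrt (hA i j)]
    rw [this, ← Complex.normSq_eq_norm_sq, Complex.star_def, Complex.mul_conj]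
  have hd : ∃ e : ℂ, star (u i) ⬝ᵥ w j = e * z j i ∧ e * star e = 1 := by
    refine Fin.lastCases ?_ (fun i => ?_) i
    · refine ⟨-1, ?_, by simp⟩
      have := hz0 j
      rw [Fin.sum_univ_castSucc] at this
      simp only [u, w, Fin.snoc_last, dotProduct, Pi.star_apply, star_one, one_mul]
      push_cast at this
      linear_combination this
    · refine ⟨1, ?_, by simp⟩
      simp [u, w, Pi.star_single]
  obtain ⟨e, he, he1⟩ := hd
  have h2 : u i ⬝ᵥ star (w j) = star (star (u i) ⬝ᵥ w j) := by
    simp [dotProduct]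
  rw [hA', Matrix.vecMulVec_mul_vecMulVec, Matrix.trace_vecMulVec, dotProduct_smul, h2, he,
    star_mul, smul_eq_mul]
  linear_combination (-(z j i * star (z j i))) * he1
end

section
/- Let A be an m×n matrix with nonnegative real entries that has the block form A = [[B, C], [D, 0]], where B is k×l, C is k×(n−l), D is (m−k)×l, and the lower-right (m−k)×(n−l) block is identically zero. Then prank(A) ≥ prank(C) + prank(D). -/
open scoped ComplexOrder

theorem prank_aux_mem {α β : Type*} {ι : Type*} [Fintype ι] [DecidableEq ι]
    (A : Matrix α β ℝ) (E : α → Matrix ι ι ℂ) (F : β → Matrix ι ι ℂ)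
    (hE : ∀ i, (E i).PosSemidef) (hF : ∀ j, (F j).PosSemidef)
    (h : ∀ i j, (A i j : ℂ) = ((E i) * (F j)).trace) :
    ∃ (E : α → Matrix (Fin (Fintype.card ι)) (Fin (Fintype.card ι)) ℂ)
      (F : β → Matrix (Fin (Fintype.card ι)) (Fin (Fintype.card ι)) ℂ),
      (∀ i, (E i).PosSemidef) ∧ (∀ j, (F j).PosSemidef) ∧
      ∀ i j, (A i j : ℂ) = ((E i) * (F j)).trace := by
  let e := (Fintype.equivFin ι).symm
  refine ⟨fun i => (E i).submatrix e e, fun j => (F j).submatrix e e,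
    fun i => (hE i).submatrix e, fun j => (hF j).submatrix e, fun i j => ?_⟩
  rw [h, Matrix.submatrix_mul_equiv]
  simp only [Matrix.trace, Matrix.diag, Matrix.submatrix_apply]
  exact (Equiv.sum_comp e (fun a => (E i * F j) a a)).symm

theorem prank_aux_le {α β : Type*} [Fintype α] [Fintype β] {ι : Type*} [Fintype ι] [DecidableEq ι]
    (A : Matrix α β ℝ) (E : α → Matrix ι ι ℂ) (F : β → Matrix ι ι ℂ)
    (hE : ∀ i, (E i).PosSemidef) (hF : ∀ j, (F j).PosSemidef)
    (h : ∀ i j, (A i j : ℂ) = ((E i) * (F j)).trace) : prank A ≤ Fintype.card ι :=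
  Nat.sInf_le (prank_aux_mem A E F hE hF h)

theorem psd_aux_zero {ι : Type*} [Fintype ι] [DecidableEq ι] {M : Matrix ι ι ℂ}
    (hM : M.PosSemidef) {a : ι} (ha : M a a = 0) (b : ι) : M a b = 0 := by
  have h1 := (hM.dotProduct_mulVec_zero_iff (Pi.single a 1)).mp (by simp [ha])
  have h2 := congrFun h1 b
  simp at h2
  rw [← hM.isHermitian.apply, h2, star_zero]

theorem trace_aux {ι : Type*} [Fintype ι] [DecidableEq ι] (p : ι → Prop) [DecidablePred p]
    {E F : Matrix ι ι ℂ} (hF : F.PosSemidef) (h : ∀ a, ¬ p a → F a a = 0) :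
    (E * F).trace = ((E.submatrix (Subtype.val : {a // p a} → ι) Subtype.val) *
      (F.submatrix (Subtype.val : {a // p a} → ι) Subtype.val)).trace := by
  have hr : ∀ a b, ¬ p a → F a b = 0 := fun a b ha => psd_aux_zero hF (h a ha) b
  have hc : ∀ a b, ¬ p b → F a b = 0 := fun a b hb => by
    rw [← hF.isHermitian.apply, hr b a hb, star_zero]
  have key : ∀ f : ι → ℂ, (∀ a, ¬ p a → f a = 0) → ∑ a, f a = ∑ a : {a // p a}, f a := by
    intro f hf
    rw [← Fintype.sum_subtype_add_sum_subtype p f]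
    rw [Finset.sum_eq_zero (s := (Finset.univ : Finset {a // ¬ p a})) (fun a _ => hf a.1 a.2),
      add_zero]
  simp only [Matrix.trace, Matrix.diag, Matrix.mul_apply, Matrix.submatrix_apply]
  rw [key]
  · refine Finset.sum_congr rfl fun a _ => key _ fun b hb => ?_
    rw [hr b _ hb, mul_zero]
  · intro a ha
    exact Finset.sum_eq_zero fun b _ => by rw [hc b a ha, mul_zero]

/-- For a nonnegative block matrix `A = [[B, C], [D, 0]]`,
`prank A ≥ prank C + prank D`. -/
theorem prank_fromBlocks_zero_ge {k l m' n' : ℕ}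
    (B : Matrix (Fin k) (Fin l) ℝ) (C : Matrix (Fin k) (Fin n') ℝ)
    (D : Matrix (Fin m') (Fin l) ℝ)
    (hB : ∀ i j, 0 ≤ B i j) (hC : ∀ i j, 0 ≤ C i j) (hD : ∀ i j, 0 ≤ D i j) :
    prank C + prank D ≤ prank (Matrix.fromBlocks B C D 0) := by
  set A := Matrix.fromBlocks B C D 0 with hA
  have hA0 : ∀ i j, 0 ≤ A i j := by
    rintro (i | i) (j | j) <;> simp [hA, hB, hC, hD]
  have hne := prank_aux_mem A (ι := Fin l ⊕ Fin n')
    (fun i => Matrix.diagonal fun b => (A i b : ℂ))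
    (fun j => Matrix.diagonal (Pi.single j 1))
    (fun i => Matrix.PosSemidef.diagonal fun b => by
      simpa using hA0 i b)
    (fun j => Matrix.PosSemidef.diagonal fun b => by
      by_cases hb : b = j
      · subst hb; simp
      · simp [Pi.single_eq_of_ne hb])
    (fun i j => by
      rw [Matrix.diagonal_mul_diagonal, Matrix.trace_diagonal]
      rw [Finset.sum_eq_single j]
      · simp
      · intro b _ hb; simp [Pi.single_eq_of_ne hb]
      · simp)
  obtain ⟨E, F, hE, hF, h⟩ := Nat.sInf_mem (s := {r : ℕ |
    ∃ (E : _ → Matrix (Fin r) (Fin r) ℂ) (F : _ → Matrix (Fin r) (Fin r) ℂ),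
      (∀ i, (E i).PosSemidef) ∧ (∀ j, (F j).PosSemidef) ∧
      ∀ i j, (A i j : ℂ) = ((E i) * (F j)).trace}) ⟨_, hne⟩
  change prank C + prank D ≤ sInf {r : ℕ |
    ∃ (E : _ → Matrix (Fin r) (Fin r) ℂ) (F : _ → Matrix (Fin r) (Fin r) ℂ),
      (∀ i, (E i).PosSemidef) ∧ (∀ j, (F j).PosSemidef) ∧
      ∀ i j, (A i j : ℂ) = ((E i) * (F j)).trace}
  generalize sInf {r : ℕ |
    ∃ (E : _ → Matrix (Fin r) (Fin r) ℂ) (F : _ → Matrix (Fin r) (Fin r) ℂ),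
      (∀ i, (E i).PosSemidef) ∧ (∀ j, (F j).PosSemidef) ∧
      ∀ i j, (A i j : ℂ) = ((E i) * (F j)).trace} = r at *
  have hG : (∑ i : Fin m', E (Sum.inr i)).PosSemidef :=
    Matrix.posSemidef_sum _ fun i _ => hE _
  obtain ⟨U, d, hU1, hU2, hd⟩ : ∃ (U : Matrix (Fin r) (Fin r) ℂ) (d : Fin r → ℂ),
      U * U.conjTranspose = 1 ∧ U.conjTranspose * U = 1 ∧
      U.conjTranspose * (∑ i : Fin m', E (Sum.inr i)) * U = Matrix.diagonal d := by
    refine ⟨hG.isHermitian.eigenvectorUnitary, fun a => (hG.isHermitian.eigenvalues a : ℂ),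
      ?_, ?_, ?_⟩
    · exact Unitary.coe_mul_star_self _
    · exact Unitary.coe_star_mul_self _
    · have := hG.isHermitian.conjStarAlgAut_star_eigenvectorUnitary
      rw [Unitary.conjStarAlgAut_apply] at this
      simpa [Matrix.star_eq_conjTranspose, Function.comp_def] using this
  let E' := fun i => U.conjTranspose * E i * U
  let F' := fun j => U.conjTranspose * F j * U
  have hE' : ∀ i, (E' i).PosSemidef := fun i => (hE i).conjTranspose_mul_mul_same U
  have hF' : ∀ j, (F' j).PosSemidef := fun j => (hF j).conjTranspose_mul_mul_same U
  have h' : ∀ i j, (A i j : ℂ) = (E' i * F' j).trace := by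
    intro i j
    have : E' i * F' j = U.conjTranspose * (E i * F j * U) := by
      calc E' i * F' j = U.conjTranspose * E i * (U * U.conjTranspose) * F j * U := by
            simp only [E', F', Matrix.mul_assoc]
        _ = _ := by rw [hU1]; simp only [Matrix.mul_assoc, Matrix.one_mul]
    rw [h, this, Matrix.trace_mul_comm U.conjTranspose, Matrix.mul_assoc, hU1, Matrix.mul_one]
  have hsum : ∑ i : Fin m', E' (Sum.inr i) = Matrix.diagonal d := by
    rw [← hd, Finset.mul_sum, Finset.sum_mul]
  have hdE : ∀ a, d a = ∑ i : Fin m', E' (Sum.inr i) a a := by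
    intro a
    rw [← Matrix.sum_apply, hsum, Matrix.diagonal_apply_eq]
  have hd0 : ∀ a, 0 ≤ d a := fun a => by
    rw [hdE]; exact Finset.sum_nonneg fun i _ => (hE' _).diag_nonneg
  have hEz : ∀ i a, ¬ (d a ≠ 0) → E' (Sum.inr i) a a = 0 := by
    intro i a ha
    have ha := not_not.mp ha
    rw [hdE, Finset.sum_eq_zero_iff_of_nonneg (fun i _ => (hE' _).diag_nonneg)] at ha
    exact ha i (Finset.mem_univ i)
  have hFz : ∀ j a, ¬ (d a = 0) → F' (Sum.inr j) a a = 0 := by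
    intro j a ha
    have h1 : (Matrix.diagonal d * F' (Sum.inr j)).trace = 0 := by
      rw [← hsum, Finset.sum_mul, Matrix.trace_sum]
      refine Finset.sum_eq_zero fun i _ => ?_
      rw [← h']; simp [hA]
    simp only [Matrix.trace, Matrix.diag, Matrix.diagonal_mul] at h1
    rw [Finset.sum_eq_zero_iff_of_nonneg
      (fun a _ => mul_nonneg (hd0 a) (hF' _).diag_nonneg)] at h1
    exact (mul_eq_zero.mp (h1 a (Finset.mem_univ a))).resolve_left ha
  classical
  have c1 : prank C ≤ Fintype.card {a // d a = 0} :=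
    prank_aux_le C (fun i => (E' (Sum.inl i)).submatrix Subtype.val Subtype.val)
      (fun j => (F' (Sum.inr j)).submatrix Subtype.val Subtype.val)
      (fun i => (hE' _).submatrix _) (fun j => (hF' _).submatrix _)
      (fun i j => by
        refine Eq.trans ?_ (trace_aux (fun a => d a = 0) (hF' (Sum.inr j)) (hFz j))
        rw [← h']; simp [hA])
  have c2 : prank D ≤ Fintype.card {a // d a ≠ 0} :=
    prank_aux_le D (fun i => (E' (Sum.inr i)).submatrix Subtype.val Subtype.val)
      (fun j => (F' (Sum.inl j)).submatrix Subtype.val Subtype.val)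
      (fun i => (hE' _).submatrix _) (fun j => (hF' _).submatrix _)
      (fun i j => by
        rw [Matrix.trace_mul_comm]
        refine Eq.trans ?_ (trace_aux (fun a => d a ≠ 0) (hE' (Sum.inr i)) (hEz i))
        rw [Matrix.trace_mul_comm, ← h']; simp [hA])
  have c3 := Fintype.card_subtype_compl (fun a => d a = 0)
  have c4 := Fintype.card_subtype_le (fun a => d a = 0)
  rw [Fintype.card_fin] at c3 c4
  change Fintype.card {a // d a ≠ 0} = _ at c3
  omega
end

section
/- For every positive integer n, the PSD-rank of the disjointness matrix D_n equals 2^n, i.e. prank(D_n) = 2^n. -/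
open scoped ComplexOrder

theorem aux_mul_zero {r : ℕ} {E F : Matrix (Fin r) (Fin r) ℂ} (hE : E.PosSemidef)
    (hF : F.PosSemidef) (h : (E * F).trace = 0) : E * F = 0 := by
  open scoped Matrix MatrixOrder Matrix.Norms.L2Operator in
  obtain ⟨A, rfl⟩ : ∃ A : Matrix (Fin r) (Fin r) ℂ, E = Aᴴ * A :=
    CStarAlgebra.nonneg_iff_eq_star_mul_self.mp (Matrix.PosSemidef.nonneg hE)
  open scoped Matrix MatrixOrder Matrix.Norms.L2Operator in
  obtain ⟨B, rfl⟩ : ∃ B : Matrix (Fin r) (Fin r) ℂ, F = Bᴴ * B :=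
    CStarAlgebra.nonneg_iff_eq_star_mul_self.mp (Matrix.PosSemidef.nonneg hF)
  have h0 : A * B.conjTranspose = 0 := by
    rw [← Matrix.trace_conjTranspose_mul_self_eq_zero_iff, ← h, Matrix.conjTranspose_mul,
      Matrix.conjTranspose_conjTranspose, Matrix.mul_assoc, Matrix.trace_mul_comm]
    simp only [Matrix.mul_assoc]
  calc _ = A.conjTranspose * (A * B.conjTranspose) * B := by simp only [Matrix.mul_assoc]
    _ = 0 := by rw [h0]; simp

theorem aux_lower {n r : ℕ} (E F : Finset (Fin n) → Matrix (Fin r) (Fin r) ℂ)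
    (hz : ∀ x y, ¬ Disjoint x y → E x * F y = 0)
    (hnz : ∀ x y, Disjoint x y → E x * F y ≠ 0) : 2 ^ n ≤ r := by
  have hv : ∀ x, ∃ v, Matrix.mulVec (E x * F xᶜ) v ≠ 0 := by
    intro x
    by_contra! hc
    apply hnz x xᶜ disjoint_compl_right
    ext i j
    have := congrFun (hc (Pi.single j 1)) i
    simpa using this
  choose v hv using hv
  have hli : LinearIndependent ℂ (fun x => Matrix.mulVec (F xᶜ) (v x)) := by
    rw [Fintype.linearIndependent_iff]
    intro g hg
    by_contra! hc
    obtain ⟨x, hx⟩ := Set.Finite.exists_maximal (Set.toFinite {x | g x ≠ 0}) hc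
    have h1 := congrArg (Matrix.mulVec (E x)) hg
    rw [Matrix.mulVec_sum, Matrix.mulVec_zero, Finset.sum_eq_single x] at h1
    · rw [Matrix.mulVec_smul, Matrix.mulVec_mulVec] at h1
      rcases smul_eq_zero.mp h1 with h | h
      · exact hx.prop h
      · exact hv x h
    · intro y _ hyx
      rw [Matrix.mulVec_smul, Matrix.mulVec_mulVec]
      by_cases hxy : x ≤ y
      · have : g y = 0 := by
          by_contra hgy
          exact hyx (le_antisymm (hx.le_of_ge hgy hxy) hxy)
        rw [this, zero_smul]
      · rw [hz x yᶜ, Matrix.zero_mulVec, smul_zero]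
        rwa [disjoint_compl_right_iff]
    · simp
  simpa using hli.fintype_card_le_finrank

/-- The PSD-rank of the disjointness matrix `D_n` equals `2 ^ n`. -/
theorem prank_disjointness {n : ℕ} (hn : 0 < n)
    (D : Matrix (Finset (Fin n)) (Finset (Fin n)) ℝ)
    (hD : ∀ x y, D x y = if Disjoint x y then 1 else 0) :
    prank D = 2 ^ n := by
  have hmem : 2 ^ n ∈ {r : ℕ |
    ∃ (E : Finset (Fin n) → Matrix (Fin r) (Fin r) ℂ)
      (F : Finset (Fin n) → Matrix (Fin r) (Fin r) ℂ),
      (∀ i, (E i).PosSemidef) ∧ (∀ j, (F j).PosSemidef) ∧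
      ∀ i j, (D i j : ℂ) = ((E i) * (F j)).trace} := by
    have e : Finset (Fin n) ≃ Fin (2 ^ n) := Fintype.equivFinOfCardEq (by simp)
    refine ⟨fun x => Matrix.diagonal (Pi.single (e x) 1),
      fun y => Matrix.diagonal (fun i => (D (e.symm i) y : ℂ)), ?_, ?_, ?_⟩
    · intro x
      rw [Matrix.posSemidef_diagonal_iff]
      intro i
      by_cases h : i = e x
      · subst h; simp
      · simp [h]
    · intro y
      rw [Matrix.posSemidef_diagonal_iff]
      intro i
      rw [hD]
      split_ifs <;> simp
    · intro x y
      rw [Matrix.diagonal_mul_diagonal, Matrix.trace_diagonal, Finset.sum_eq_single (e x)]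
      · simp
      · intro b _ hb
        simp [hb]
      · simp
  apply le_antisymm
  · exact Nat.sInf_le hmem
  · apply le_csInf ⟨_, hmem⟩
    rintro r ⟨E, F, hE, hF, h⟩
    apply aux_lower E F
    · intro x y hxy
      apply aux_mul_zero (hE x) (hF y)
      rw [← h, hD, if_neg hxy]; simp
    · intro x y hxy h0
      have := h x y
      rw [h0, hD, if_pos hxy] at this
      simp at this
end

section
/- For every matrix A with nonnegative real entries, prank(A) ≤ rprank(A) ≤ 2 · prank(A). -/
open scoped ComplexOrder

/-- The real PSD-rank: as `prank`, but the factorization matrices are required to be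
real symmetric positive semidefinite matrices. -/
noncomputable def rprank {α β : Type*} [Fintype α] [Fintype β] (A : Matrix α β ℝ) : ℕ :=
  sInf {r : ℕ |
    ∃ (E : α → Matrix (Fin r) (Fin r) ℝ) (F : β → Matrix (Fin r) (Fin r) ℝ),
      (∀ i, (E i).PosSemidef) ∧ (∀ j, (F j).PosSemidef) ∧
      ∀ i j, A i j = ((E i) * (F j)).trace}

open scoped MatrixOrder in
lemma psd_factor {𝕜 : Type*} [RCLike 𝕜] {r : ℕ} {M : Matrix (Fin r) (Fin r) 𝕜}
    (h : M.PosSemidef) : ∃ B : Matrix (Fin r) (Fin r) 𝕜, M = B.conjTranspose * B :=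
  CStarAlgebra.nonneg_iff_eq_star_mul_self.mp h.nonneg

/-- realification of a complex matrix -/
def realify {r : ℕ} (M : Matrix (Fin r) (Fin r) ℂ) :
    Matrix (Fin r ⊕ Fin r) (Fin r ⊕ Fin r) ℝ :=
  Matrix.fromBlocks (M.map Complex.re) (-(M.map Complex.im)) (M.map Complex.im) (M.map Complex.re)

lemma realify_mul {r : ℕ} (M N : Matrix (Fin r) (Fin r) ℂ) :
    realify (M * N) = realify M * realify N := by
  unfold realify
  rw [Matrix.fromBlocks_multiply]
  congr 1 <;> ext i j <;>
    simp [Matrix.mul_apply, Finset.sum_add_distrib, Finset.sum_sub_distrib] <;> ring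

lemma realify_conjTranspose {r : ℕ} (M : Matrix (Fin r) (Fin r) ℂ) :
    realify M.conjTranspose = (realify M).conjTranspose := by
  unfold realify
  rw [Matrix.fromBlocks_conjTranspose]
  congr 1 <;> ext i j <;> simp

lemma realify_trace {r : ℕ} (M : Matrix (Fin r) (Fin r) ℂ) :
    (realify M).trace = 2 * M.trace.re := by
  simp [realify, Matrix.trace, two_mul]

lemma realify_posSemidef {r : ℕ} {M : Matrix (Fin r) (Fin r) ℂ} (h : M.PosSemidef) :
    (realify M).PosSemidef := by
  obtain ⟨B, rfl⟩ := psd_factor h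
  rw [realify_mul, realify_conjTranspose]
  exact Matrix.posSemidef_conjTranspose_mul_self _

lemma complexify_posSemidef {r : ℕ} {M : Matrix (Fin r) (Fin r) ℝ} (h : M.PosSemidef) :
    (M.map Complex.ofRealHom).PosSemidef := by
  obtain ⟨B, rfl⟩ := psd_factor h
  have : (B.conjTranspose * B).map Complex.ofRealHom
      = (B.map Complex.ofRealHom).conjTranspose * B.map Complex.ofRealHom := by
    rw [Matrix.map_mul]
    congr 1
    ext i j
    simp
  rw [this]
  exact Matrix.posSemidef_conjTranspose_mul_self _

/-- For every nonnegative matrix `A`, `prank A ≤ rprank A ≤ 2 * prank A`. -/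
theorem prank_le_rprank_le_two_mul {m n : ℕ}
    (A : Matrix (Fin m) (Fin n) ℝ) (hA : ∀ i j, 0 ≤ A i j) :
    prank A ≤ rprank A ∧ rprank A ≤ 2 * prank A := by
  have key : ∀ r : ℕ, (∃ (E : Fin m → Matrix (Fin r) (Fin r) ℝ)
      (F : Fin n → Matrix (Fin r) (Fin r) ℝ),
      (∀ i, (E i).PosSemidef) ∧ (∀ j, (F j).PosSemidef) ∧
      ∀ i j, A i j = ((E i) * (F j)).trace) →
      ∃ (E : Fin m → Matrix (Fin r) (Fin r) ℂ) (F : Fin n → Matrix (Fin r) (Fin r) ℂ),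
      (∀ i, (E i).PosSemidef) ∧ (∀ j, (F j).PosSemidef) ∧
      ∀ i j, (A i j : ℂ) = ((E i) * (F j)).trace := by
    rintro r ⟨E, F, hE, hF, h⟩
    refine ⟨fun i => (E i).map Complex.ofRealHom, fun j => (F j).map Complex.ofRealHom,
      fun i => complexify_posSemidef (hE i), fun j => complexify_posSemidef (hF j), ?_⟩
    intro i j
    rw [h]
    simp [Matrix.trace, Matrix.mul_apply]
  have hne : ∃ r : ℕ, ∃ (E : Fin m → Matrix (Fin r) (Fin r) ℝ)
      (F : Fin n → Matrix (Fin r) (Fin r) ℝ),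
      (∀ i, (E i).PosSemidef) ∧ (∀ j, (F j).PosSemidef) ∧
      ∀ i j, A i j = ((E i) * (F j)).trace := by
    refine ⟨m, fun i => Matrix.diagonal (Pi.single i 1),
      fun j => Matrix.diagonal (fun i => A i j), ?_, ?_, ?_⟩
    · intro i
      refine Matrix.PosSemidef.diagonal ?_
      intro k
      by_cases hk : k = i
      · subst hk; simp
      · simp [hk]
    · intro j
      exact Matrix.PosSemidef.diagonal (fun k => hA k j)
    · intro i j
      simp [Matrix.diagonal_mul_diagonal, Matrix.trace_diagonal, Pi.single_apply]
  constructor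
  · exact Nat.sInf_le (key _ (Nat.sInf_mem hne))
  · obtain ⟨r, hr⟩ := hne
    have hp : ∃ (E : Fin m → Matrix (Fin (prank A)) (Fin (prank A)) ℂ)
        (F : Fin n → Matrix (Fin (prank A)) (Fin (prank A)) ℂ),
      (∀ i, (E i).PosSemidef) ∧ (∀ j, (F j).PosSemidef) ∧
      ∀ i j, (A i j : ℂ) = ((E i) * (F j)).trace := Nat.sInf_mem (s := {r : ℕ |
      ∃ (E : Fin m → Matrix (Fin r) (Fin r) ℂ) (F : Fin n → Matrix (Fin r) (Fin r) ℂ),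
      (∀ i, (E i).PosSemidef) ∧ (∀ j, (F j).PosSemidef) ∧
      ∀ i j, (A i j : ℂ) = ((E i) * (F j)).trace}) ⟨r, key r hr⟩
    obtain ⟨E, F, hE, hF, h⟩ := hp
    let e : Fin (2 * prank A) ≃ Fin (prank A) ⊕ Fin (prank A) :=
      (finCongr (two_mul _)).trans finSumFinEquiv.symm
    refine Nat.sInf_le ⟨fun i => (realify (E i)).submatrix e e,
      fun j => ((1/2 : ℝ) • realify (F j)).submatrix e e, ?_, ?_, ?_⟩
    · exact fun i => (realify_posSemidef (hE i)).submatrix e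
    · exact fun j => ((realify_posSemidef (hF j)).smul (by norm_num)).submatrix e
    · intro i j
      have h1 := congrArg Complex.re (h i j)
      beta_reduce
      rw [Matrix.submatrix_mul_equiv]
      have h2 : ∀ M : Matrix (Fin (prank A) ⊕ Fin (prank A)) (Fin (prank A) ⊕ Fin (prank A)) ℝ,
          (M.submatrix e e).trace = M.trace := fun M => by
        simpa [Matrix.trace] using e.sum_comp (fun k => M k k)
      rw [h2, Matrix.mul_smul, ← realify_mul, Matrix.trace_smul, realify_trace]
      rw [Complex.ofReal_re] at h1
      rw [h1, smul_eq_mul]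
      ring
end

section
/- Let P be an m×n matrix with nonnegative real entries in which every column sums to 1, and suppose prank(P) = r. Then there exist r×r complex Hermitian positive semidefinite matrices E_1,…,E_m and F_1,…,F_n such that P(i,j) = Tr(E_i F_j) for all i,j, and moreover ∑_{i=1}^m E_i = I_r (the r×r identity) and Tr(F_j) = 1 for every j. -/
open scoped ComplexOrder

/-- square root and its pseudo-inverse -/
theorem sqrt_pinv {r : ℕ} (S : Matrix (Fin r) (Fin r) ℂ) (hS : S.PosSemidef) :
    ∃ R T : Matrix (Fin r) (Fin r) ℂ, R.conjTranspose = R ∧ T.conjTranspose = T ∧ R * R = S ∧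
      T * R = R * T ∧ R * T * R = R := by
  have hs := hS.isHermitian.spectral_theorem
  set φ := Unitary.conjStarAlgAut ℂ _ hS.isHermitian.eigenvectorUnitary
  set d := hS.isHermitian.eigenvalues
  have hd : ∀ i, 0 ≤ d i := hS.eigenvalues_nonneg
  refine ⟨φ (Matrix.diagonal fun i => ((√(d i) : ℝ) : ℂ)),
    φ (Matrix.diagonal fun i => (((√(d i))⁻¹ : ℝ) : ℂ)), ?_, ?_, ?_, ?_, ?_⟩
  · rw [← Matrix.star_eq_conjTranspose, ← map_star, Matrix.star_eq_conjTranspose,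
      Matrix.diagonal_conjTranspose]
    congr 2; ext i; simp
  · rw [← Matrix.star_eq_conjTranspose, ← map_star, Matrix.star_eq_conjTranspose,
      Matrix.diagonal_conjTranspose]
    congr 2; ext i; simp
  · rw [hs, ← map_mul, Matrix.diagonal_mul_diagonal]
    congr 2; ext i
    simp only [Function.comp]
    rw [← Complex.ofReal_mul, Real.mul_self_sqrt (hd i)]; rfl
  · rw [← map_mul, ← map_mul, Matrix.diagonal_mul_diagonal, Matrix.diagonal_mul_diagonal]
    congr 2; ext i; exact mul_comm _ _
  · rw [← map_mul, ← map_mul, Matrix.diagonal_mul_diagonal, Matrix.diagonal_mul_diagonal]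
    congr 2; ext i
    rw [← Complex.ofReal_mul, ← Complex.ofReal_mul, mul_inv_mul_cancel]

theorem mul_eq_zero_of_conj {r : ℕ} (E X : Matrix (Fin r) (Fin r) ℂ) (hE : E.PosSemidef)
    (h : X.conjTranspose * E * X = 0) : E * X = 0 := by
  obtain ⟨R, T, hR, -, rfl, -, -⟩ := sqrt_pinv E hE
  have : (R * X).conjTranspose * (R * X) = 0 := by
    rw [Matrix.conjTranspose_mul, hR, ← h]; noncomm_ring
  rw [Matrix.conjTranspose_mul_self_eq_zero] at this
  rw [Matrix.mul_assoc, this, Matrix.mul_zero]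

theorem prank_mem {m n : ℕ} (P : Matrix (Fin m) (Fin n) ℝ) (hP : ∀ i j, 0 ≤ P i j) :
    ∃ (E : Fin m → Matrix (Fin (prank P)) (Fin (prank P)) ℂ)
      (F : Fin n → Matrix (Fin (prank P)) (Fin (prank P)) ℂ),
      (∀ i, (E i).PosSemidef) ∧ (∀ j, (F j).PosSemidef) ∧
      ∀ i j, (P i j : ℂ) = ((E i) * (F j)).trace := by
  refine Nat.sInf_mem (s := {r : ℕ |
    ∃ (E : Fin m → Matrix (Fin r) (Fin r) ℂ) (F : Fin n → Matrix (Fin r) (Fin r) ℂ),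
      (∀ i, (E i).PosSemidef) ∧ (∀ j, (F j).PosSemidef) ∧
      ∀ i j, (P i j : ℂ) = ((E i) * (F j)).trace}) ⟨m, fun i => Matrix.diagonal (Pi.single i 1),
      fun j => Matrix.diagonal fun i => (P i j : ℂ), ?_, ?_, ?_⟩
  · intro i
    refine Matrix.PosSemidef.diagonal ?_
    intro k
    by_cases h : k = i
    · subst h; simp
    · simp [h]
  · intro j
    refine Matrix.PosSemidef.diagonal ?_
    intro k
    simpa using hP k j
  · intro i j
    simp [Matrix.diagonal_mul_diagonal, Matrix.trace_diagonal, Pi.single_apply]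

/-- A column-stochastic nonnegative matrix `P` with `prank P = r` has a size-`r`
PSD-factorization in which the `E i` form a POVM (`∑ i, E i = 1`) and the `F j`
are quantum states (`Tr (F j) = 1`). -/
theorem exists_povm_state_factorization {m n r : ℕ}
    (P : Matrix (Fin m) (Fin n) ℝ) (hP : ∀ i j, 0 ≤ P i j)
    (hcol : ∀ j, ∑ i, P i j = 1) (hr : prank P = r) :
    ∃ (E : Fin m → Matrix (Fin r) (Fin r) ℂ) (F : Fin n → Matrix (Fin r) (Fin r) ℂ),
      (∀ i, (E i).PosSemidef) ∧ (∀ j, (F j).PosSemidef) ∧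
      (∀ i j, (P i j : ℂ) = ((E i) * (F j)).trace) ∧
      (∑ i, E i = 1) ∧ (∀ j, (F j).trace = 1) := by
  have key := prank_mem P hP
  have hmr : m = 0 → prank P = 0 := by
    intro hm
    subst hm
    refine Nat.le_zero.mp (Nat.sInf_le ⟨fun _ => 0, fun _ => 0, fun _ => .zero, fun _ => .zero,
      fun i => i.elim0⟩)

  rw [hr] at key hmr
  obtain ⟨E, F, hE, hF, hEF⟩ := key
  rcases Nat.eq_zero_or_pos m with hm | hm
  · obtain rfl := hmr hm
    subst hm
    have hn : ∀ j : Fin n, False := fun j => by simpa using hcol j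
    exact ⟨E, F, hE, hF, hEF, Subsingleton.elim _ _, fun j => (hn j).elim⟩
  have hS : (∑ i, E i).PosSemidef := Matrix.posSemidef_sum _ fun i _ => hE i
  obtain ⟨R, T, hR, hT, hRR, hTR, hRTR⟩ := sqrt_pinv _ hS
  set Q := R * T with hQ
  have hQH : Q.conjTranspose = Q := by rw [hQ, Matrix.conjTranspose_mul, hR, hT, hTR]
  have hQQ : Q * Q = Q := by
    rw [hQ, ← Matrix.mul_assoc, ← hQ, hRTR]
  have hXH : (1 - Q).conjTranspose = 1 - Q := by
    rw [Matrix.conjTranspose_sub, hQH, Matrix.conjTranspose_one]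
  have hXX : (1 - Q) * (1 - Q) = 1 - Q := by
    rw [Matrix.mul_sub, Matrix.sub_mul, Matrix.sub_mul, hQQ]; simp
  have hXR : (1 - Q) * R = 0 := by rw [Matrix.sub_mul, hRTR]; simp
  have hXpsd : (1 - Q).PosSemidef := by
    have := Matrix.posSemidef_conjTranspose_mul_self (1 - Q)
    rwa [hXH, hXX] at this
  have hEX : ∀ i, E i * (1 - Q) = 0 := by
    have hp : ∀ i, ((1 - Q).conjTranspose * E i * (1 - Q)).PosSemidef :=
      fun i => (hE i).conjTranspose_mul_mul_same _
    have hsum : ∑ i, ((1 - Q).conjTranspose * E i * (1 - Q)) = 0 := by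
      rw [← Finset.sum_mul, ← Finset.mul_sum, ← hRR, hXH, ← Matrix.mul_assoc, hXR]; simp
    have htr : ∑ i, ((1 - Q).conjTranspose * E i * (1 - Q)).trace = 0 := by
      rw [← Matrix.trace_sum, hsum, Matrix.trace_zero]
    rw [Finset.sum_eq_zero_iff_of_nonneg fun i _ => (hp i).trace_nonneg] at htr
    intro i
    exact mul_eq_zero_of_conj _ _ (hE i) ((hp i).trace_eq_zero_iff.mp (htr i (Finset.mem_univ _)))
  have hEQ : ∀ i, E i * Q = E i := fun i => by
    have := hEX i
    rw [Matrix.mul_sub, Matrix.mul_one, sub_eq_zero] at this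
    exact this.symm
  have hQE : ∀ i, Q * E i = E i := fun i => by
    have := congrArg Matrix.conjTranspose (hEQ i)
    rwa [Matrix.conjTranspose_mul, hQH, (hE i).isHermitian.eq] at this
  have hp1 : ∀ i, (T * E i * T).PosSemidef := fun i => by
    have := (hE i).conjTranspose_mul_mul_same T
    rwa [hT] at this
  refine ⟨fun i => T * E i * T + if i = ⟨0, hm⟩ then 1 - Q else 0, fun j => R * F j * R,
    ?_, ?_, ?_, ?_, ?_⟩
  · intro i
    refine (hp1 i).add ?_
    split_ifs
    exacts [hXpsd, .zero]
  · intro j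
    have := (hF j).conjTranspose_mul_mul_same R
    rwa [hR] at this
  · intro i j
    have h0 : (if i = ⟨0, hm⟩ then 1 - Q else 0) * (R * F j * R) = 0 := by
      split_ifs
      · rw [← Matrix.mul_assoc, ← Matrix.mul_assoc, hXR]; simp
      · simp
    have h1 : (T * E i * T * (R * F j * R)).trace = (R * T * E i * (T * R) * F j).trace := by
      rw [← Matrix.mul_assoc, Matrix.trace_mul_comm]
      congr 1; noncomm_ring
    rw [Matrix.add_mul, h0, add_zero, h1, hTR, ← hQ, hQE, hEQ, hEF]
  · rw [Finset.sum_add_distrib, ← Finset.sum_mul, ← Finset.mul_sum, ← hRR, Finset.sum_ite_eq']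
    have : T * (R * R) * T = Q * Q := by
      rw [← Matrix.mul_assoc, hTR, Matrix.mul_assoc, ← hQ]
    rw [this, hQQ]; simp
  · intro j
    rw [Matrix.trace_mul_comm, ← Matrix.mul_assoc, hRR, Finset.sum_mul, Matrix.trace_sum]
    simp_rw [← hEF]
    exact_mod_cast hcol j
end

section
/- Let P be an m×n matrix with nonnegative real entries in which every column sums to 1, and let q = (q_1,…,q_n) be any probability distribution on the colum31ns (q_j ≥ 0, ∑_j q_j = 1). Then prank(P) · ∑_{i=1}^n ∑_{j=1}^n q_i q_j F(P_i, P_j)² ≥ 1, where P_i denotes the i-th column of P. Equivalently, prank(P) ≥ 1 / (∑_{i,j} q_i q_j F(P_i,P_j)²). -/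
open scoped ComplexOrder

open scoped MatrixOrder Matrix.Norms.L2Operator in
lemma aux_dec {r : ℕ} {M : Matrix (Fin r) (Fin r) ℂ} (h : M.PosSemidef) :
    ∃ B : Matrix (Fin r) (Fin r) ℂ, M = B.conjTranspose * B :=
  CStarAlgebra.nonneg_iff_eq_star_mul_self.mp h.nonneg

open scoped Matrix.Norms.Frobenius in
lemma aux_norm_sq {r : ℕ} (M : Matrix (Fin r) (Fin r) ℂ) :
    ((‖M‖ ^ 2 : ℝ) : ℂ) = (M * M.conjTranspose).trace := by
  have h : ‖M‖ ^ 2 = ∑ i, ∑ j, ‖M i j‖ ^ 2 := by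
    rw [Matrix.frobenius_norm_def, ← Real.sqrt_eq_rpow, Real.sq_sqrt (by positivity)]
    simp
  rw [h]
  simp [Matrix.trace, Matrix.mul_apply, Complex.mul_conj, Complex.normSq_eq_norm_sq]

open scoped Matrix.Norms.Frobenius in
lemma aux_trace {r : ℕ} (M N : Matrix (Fin r) (Fin r) ℂ) :
    ‖(M * N).trace‖ ≤ ‖M‖ * ‖N‖ := by
  have e : ∀ K : Matrix (Fin r) (Fin r) ℂ, ‖K‖ ^ 2 = ∑ p : Fin r × Fin r, ‖K p.1 p.2‖ ^ 2 := by
    intro K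
    rw [Matrix.frobenius_norm_def, ← Real.sqrt_eq_rpow, Real.sq_sqrt (by positivity),
      Fintype.sum_prod_type]
    simp
  have e2 : ‖N‖ ^ 2 = ∑ p : Fin r × Fin r, ‖N p.2 p.1‖ ^ 2 := by
    rw [e, Fintype.sum_prod_type, Fintype.sum_prod_type, Finset.sum_comm]
  have h1 : ‖(M * N).trace‖ ≤ ∑ p : Fin r × Fin r, ‖M p.1 p.2‖ * ‖N p.2 p.1‖ := by
    rw [Fintype.sum_prod_type]
    simp only [Matrix.trace, Matrix.diag, Matrix.mul_apply]
    refine (norm_sum_le _ _).trans (Finset.sum_le_sum fun i _ => ?_)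
    refine (norm_sum_le _ _).trans (Finset.sum_le_sum fun j _ => ?_)
    rw [norm_mul]
  have h2 := Finset.sum_mul_sq_le_sq_mul_sq Finset.univ
    (fun p : Fin r × Fin r => ‖M p.1 p.2‖) (fun p => ‖N p.2 p.1‖)
  rw [← e, ← e2, ← mul_pow] at h2
  exact h1.trans (le_of_sq_le_sq h2 (by positivity))

lemma aux_fact {m n : ℕ} (P : Matrix (Fin m) (Fin n) ℝ) (hP : ∀ i j, 0 ≤ P i j) :
    ∃ (E : Fin m → Matrix (Fin m) (Fin m) ℂ) (F : Fin n → Matrix (Fin m) (Fin m) ℂ),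
      (∀ i, (E i).PosSemidef) ∧ (∀ j, (F j).PosSemidef) ∧
      ∀ i j, (P i j : ℂ) = ((E i) * (F j)).trace := by
  refine ⟨fun i => Matrix.diagonal (Pi.single i 1),
    fun j => Matrix.diagonal fun k => (P k j : ℂ), fun i => ?_, fun j => ?_, fun i j => ?_⟩
  · refine Matrix.PosSemidef.diagonal fun k => ?_
    by_cases h : k = i
    · subst h; simp
    · simp [h]
  · refine Matrix.PosSemidef.diagonal fun k => ?_
    simpa using hP k j
  · simp [Matrix.diagonal_mul_diagonal, Matrix.trace_diagonal, Pi.single_apply]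

open scoped Matrix.Norms.Frobenius in
lemma aux_fid {m n r : ℕ} (P : Matrix (Fin m) (Fin n) ℝ)
    (E : Fin m → Matrix (Fin r) (Fin r) ℂ) (F : Fin n → Matrix (Fin r) (Fin r) ℂ)
    (hE : ∀ i, (E i).PosSemidef) (hF : ∀ j, (F j).PosSemidef)
    (h : ∀ i j, (P i j : ℂ) = ((E i) * (F j)).trace) (i j : Fin n) :
    (((∑ k, E k) * F i * (∑ k, E k) * F j).trace).re ≤
      (∑ k, Real.sqrt (P k i * P k j)) ^ 2 := by
  have hE' : ∀ k, ∃ B : Matrix (Fin r) (Fin r) ℂ, E k = B.conjTranspose * B := fun k =>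
    aux_dec (hE k)
  have hF' : ∀ k, ∃ B : Matrix (Fin r) (Fin r) ℂ, F k = B.conjTranspose * B := fun k =>
    aux_dec (hF k)
  choose A hA using hE'
  choose C hC using hF'
  let Z : Fin m → Fin n → Matrix (Fin r) (Fin r) ℂ := fun k j => A k * (C j).conjTranspose
  have hZ : ∀ k j, P k j = ‖Z k j‖ ^ 2 := by
    intro k j
    have : (P k j : ℂ) = ((‖Z k j‖ ^ 2 : ℝ) : ℂ) := by
      rw [aux_norm_sq, h, hA, hC]
      simp only [Z, Matrix.conjTranspose_mul, Matrix.conjTranspose_conjTranspose]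
      rw [Matrix.mul_assoc, Matrix.trace_mul_comm]
      simp only [Matrix.mul_assoc]
    exact_mod_cast this
  have hs : ∀ k, Real.sqrt (P k i * P k j) = ‖Z k i‖ * ‖Z k j‖ := by
    intro k
    rw [hZ, hZ, ← mul_pow, Real.sqrt_sq (by positivity)]
  have hexp : (∑ k, E k) * F i * (∑ k, E k) * F j = ∑ k, ∑ l, E k * F i * E l * F j := by
    simp only [Finset.sum_mul, Finset.mul_sum]
    rw [Finset.sum_comm]
  rw [hexp, pow_two, Finset.sum_mul_sum, Matrix.trace_sum, Complex.re_sum]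
  refine Finset.sum_le_sum fun k _ => ?_
  rw [Matrix.trace_sum, Complex.re_sum]
  refine Finset.sum_le_sum fun l _ => ?_
  rw [hs, hs]
  have ht : (E k * F i * E l * F j).trace =
      ((Z k i * (Z l i).conjTranspose) * (Z l j * (Z k j).conjTranspose)).trace := by
    rw [hA, hA, hC, hC]
    simp only [Z, Matrix.conjTranspose_mul, Matrix.conjTranspose_conjTranspose]
    simp only [Matrix.mul_assoc]
    rw [Matrix.trace_mul_comm]
    simp only [Matrix.mul_assoc]
  rw [ht]
  calc _ ≤ _ := Complex.re_le_norm _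
    _ ≤ _ := aux_trace _ _
    _ ≤ (‖Z k i‖ * ‖(Z l i).conjTranspose‖) * (‖Z l j‖ * ‖(Z k j).conjTranspose‖) := by
        gcongr <;> exact Matrix.frobenius_norm_mul _ _
    _ = _ := by
        rw [Matrix.frobenius_norm_conjTranspose, Matrix.frobenius_norm_conjTranspose]; ring

open scoped Matrix.Norms.Frobenius in
lemma aux_low {r : ℕ} (S G : Matrix (Fin r) (Fin r) ℂ) (hS : S.PosSemidef) (hG : G.PosSemidef)
    (h : (S * G).trace = 1) : 1 ≤ (r : ℝ) * ((S * G * S * G).trace).re := by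
  obtain ⟨B, rfl⟩ := aux_dec hS
  have hX : (B * G * B.conjTranspose).trace = 1 := by
    rw [← h, Matrix.mul_assoc, Matrix.mul_assoc, Matrix.trace_mul_comm, Matrix.mul_assoc,
      Matrix.trace_mul_comm]
    simp only [Matrix.mul_assoc]
    try rw [Matrix.trace_mul_comm]
    try simp only [Matrix.mul_assoc]
  have h2 := aux_norm_sq (B * G * B.conjTranspose)
  have h3 : ((B * G * B.conjTranspose) * (B * G * B.conjTranspose).conjTranspose).trace =
      (B.conjTranspose * B * G * (B.conjTranspose * B) * G).trace := by
    simp only [Matrix.conjTranspose_mul, Matrix.conjTranspose_conjTranspose, hG.1.eq]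
    rw [Matrix.trace_mul_comm (B.conjTranspose * B * G * (B.conjTranspose * B)) G]
    simp only [Matrix.mul_assoc]
    rw [Matrix.trace_mul_comm]
    simp only [Matrix.mul_assoc]
  rw [← h3, ← h2, Complex.ofReal_re]
  have h4 := aux_trace (B * G * B.conjTranspose) 1
  rw [Matrix.mul_one, hX, norm_one] at h4
  have h5 := aux_norm_sq (1 : Matrix (Fin r) (Fin r) ℂ)
  rw [Matrix.conjTranspose_one, Matrix.mul_one, Matrix.trace_one, Fintype.card_fin] at h5
  have h6 : ‖(1 : Matrix (Fin r) (Fin r) ℂ)‖ ^ 2 = (r : ℝ) := by exact_mod_cast h5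
  rw [← h6, ← mul_pow, mul_comm]
  exact one_le_pow₀ h4

/-- Fidelity lower bound on PSD-rank: for a column-stochastic nonnegative matrix `P`
and any probability distribution `q` on the columns,
`prank P * ∑_{i,j} q i * q j * F(P_i, P_j)² ≥ 1`,
where `F(P_i, P_j) = ∑_k √(P k i * P k j)` is the fidelity of columns `i` and `j`. -/
theorem prank_fidelity_lower_bound {m n : ℕ}
    (P : Matrix (Fin m) (Fin n) ℝ) (hP : ∀ i j, 0 ≤ P i j)
    (hcol : ∀ j, ∑ i, P i j = 1)
    (q : Fin n → ℝ) (hq : ∀ j, 0 ≤ q j) (hq1 : ∑ j, q j = 1) :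
    1 ≤ (prank P : ℝ) *
      ∑ i, ∑ j, q i * q j * (∑ k, Real.sqrt (P k i * P k j)) ^ 2 := by
  obtain ⟨E, F, hE, hF, h⟩ := Nat.sInf_mem (s := {r : ℕ |
    ∃ (E : Fin m → Matrix (Fin r) (Fin r) ℂ) (F : Fin n → Matrix (Fin r) (Fin r) ℂ),
      (∀ i, (E i).PosSemidef) ∧ (∀ j, (F j).PosSemidef) ∧
      ∀ i j, (P i j : ℂ) = ((E i) * (F j)).trace}) ⟨m, aux_fact P hP⟩
  change Fin m → Matrix (Fin (prank P)) (Fin (prank P)) ℂ at E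
  change Fin n → Matrix (Fin (prank P)) (Fin (prank P)) ℂ at F
  have hS : (∑ k, E k).PosSemidef := Matrix.posSemidef_sum _ fun k _ => hE k
  have hG : (∑ j, (q j : ℂ) • F j).PosSemidef := Matrix.posSemidef_sum _ fun j _ =>
    (hF j).smul (by exact_mod_cast hq j)
  have hSF : ∀ j, ((∑ k, E k) * F j).trace = 1 := by
    intro j
    rw [Finset.sum_mul, Matrix.trace_sum]
    have := hcol j
    calc _ = ∑ k, (P k j : ℂ) := Finset.sum_congr rfl fun k _ => (h k j).symm
      _ = 1 := by exact_mod_cast this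
  have hT : ((∑ k, E k) * (∑ j, (q j : ℂ) • F j)).trace = 1 := by
    rw [Finset.mul_sum, Matrix.trace_sum]
    simp only [Matrix.mul_smul, Matrix.trace_smul, hSF, smul_eq_mul, mul_one]
    exact_mod_cast hq1
  refine (aux_low _ _ hS hG hT).trans ?_
  refine mul_le_mul_of_nonneg_left ?_ (Nat.cast_nonneg _)
  have hexp : (∑ k, E k) * (∑ j, (q j : ℂ) • F j) * (∑ k, E k) * (∑ j, (q j : ℂ) • F j) =
      ∑ i, ∑ j, ((q i * q j : ℝ) : ℂ) • ((∑ k, E k) * F i * (∑ k, E k) * F j) := by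
    generalize (∑ k, E k) = S
    simp only [Finset.mul_sum, Finset.sum_mul]
    rw [Finset.sum_comm]
    refine Finset.sum_congr rfl fun i _ => Finset.sum_congr rfl fun j _ => ?_
    simp only [Matrix.mul_smul, Matrix.smul_mul, smul_smul, Complex.ofReal_mul]
    rw [mul_comm]
  rw [hexp, Matrix.trace_sum, Complex.re_sum]
  refine Finset.sum_le_sum fun i _ => ?_
  rw [Matrix.trace_sum, Complex.re_sum]
  refine Finset.sum_le_sum fun j _ => ?_
  rw [Matrix.trace_smul, smul_eq_mul, Complex.re_ofReal_mul]
  exact mul_le_mul_of_nonneg_left (aux_fid P E F hE hF h i j) (mul_nonneg (hq i) (hq j))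
end

section
/- Let P be an m×n matrix with nonnegative real entries in which every column sums to 1. Then prank(P) ≥ ∑_{i=1}^m max_{1 ≤ j ≤ n} P(i,j). -/
open scoped ComplexOrder

section aux

open scoped MatrixOrder in
theorem aux_exists {r : ℕ} {A : Matrix (Fin r) (Fin r) ℂ} (hA : A.PosSemidef) :
    ∃ B : Matrix (Fin r) (Fin r) ℂ, A = B.conjTranspose * B := by
  refine ⟨CFC.sqrt A, ?_⟩
  rw [(Matrix.nonneg_iff_posSemidef.1 (CFC.sqrt_nonneg A)).isHermitian.eq, CFC.sqrt_mul_sqrt_self A hA.nonneg]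

open Matrix

attribute [local instance] Matrix.frobeniusNormedAddCommGroup

theorem aux_trace_norm {r : ℕ} (A : Matrix (Fin r) (Fin r) ℂ) :
    (Aᴴ * A).trace.re = ‖A‖ ^ 2 := by
  have h : ‖A‖ ^ 2 = ∑ i, ∑ j, ‖A i j‖ ^ 2 := by
    rw [Matrix.frobenius_norm_def, ← Real.sqrt_eq_rpow, Real.sq_sqrt]
    · simp
    · positivity
  rw [h, Finset.sum_comm]
  simp only [Matrix.trace, Matrix.diag, Matrix.mul_apply, Matrix.conjTranspose_apply,
    Complex.re_sum]
  refine Finset.sum_congr rfl fun i _ => Finset.sum_congr rfl fun j _ => ?_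
  rw [← Complex.normSq_eq_norm_sq, Complex.normSq_apply]
  simp

theorem aux_trace_le {r : ℕ} {T E F : Matrix (Fin r) (Fin r) ℂ} (hT : T.PosDef)
    (hE : E.PosSemidef) (hF : F.PosSemidef) :
    (E * F).trace.re ≤ (T⁻¹ * E).trace.re * (T * F).trace.re := by
  obtain ⟨C, rfl⟩ := aux_exists hE
  obtain ⟨D, rfl⟩ := aux_exists hF
  obtain ⟨B, rfl⟩ := aux_exists hT.posSemidef
  have hB : IsUnit B.det := by
    have := hT.isUnit
    rw [Matrix.isUnit_iff_isUnit_det, Matrix.det_mul] at this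
    exact isUnit_of_mul_isUnit_right this
  have h1 : (Cᴴ * C * (Dᴴ * D)).trace.re = ‖C * Dᴴ‖ ^ 2 := by
    rw [← aux_trace_norm, Matrix.conjTranspose_mul, Matrix.conjTranspose_conjTranspose]
    rw [← Matrix.mul_assoc, Matrix.trace_mul_comm]
    simp only [Matrix.mul_assoc]
  have h2 : ((Bᴴ * B)⁻¹ * (Cᴴ * C)).trace.re = ‖C * B⁻¹‖ ^ 2 := by
    rw [← aux_trace_norm, Matrix.conjTranspose_mul, Matrix.mul_inv_rev, Matrix.mul_assoc,
      Matrix.trace_mul_comm, Matrix.conjTranspose_nonsing_inv]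
    simp only [Matrix.mul_assoc]
  have h3 : (Bᴴ * B * (Dᴴ * D)).trace.re = ‖B * Dᴴ‖ ^ 2 := by
    rw [← aux_trace_norm, Matrix.conjTranspose_mul, Matrix.conjTranspose_conjTranspose]
    rw [← Matrix.mul_assoc, Matrix.trace_mul_comm]
    simp only [Matrix.mul_assoc]
  rw [h1, h2, h3, ← mul_pow]
  have h4 : C * Dᴴ = (C * B⁻¹) * (B * Dᴴ) := by
    rw [Matrix.mul_assoc, Matrix.nonsing_inv_mul_cancel_left _ _ hB]
  rw [h4]
  gcongr
  exact Matrix.frobenius_norm_mul _ _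

theorem aux_trace_nonneg {r : ℕ} {F : Matrix (Fin r) (Fin r) ℂ} (hF : F.PosSemidef) :
    0 ≤ F.trace.re := by
  obtain ⟨D, rfl⟩ := aux_exists hF
  rw [aux_trace_norm]
  positivity

theorem aux_main {m n r : ℕ} (hn : 0 < n)
    (P : Matrix (Fin m) (Fin n) ℝ)
    (hcol : ∀ j, ∑ i, P i j = 1)
    (E : Fin m → Matrix (Fin r) (Fin r) ℂ) (F : Fin n → Matrix (Fin r) (Fin r) ℂ)
    (hE : ∀ i, (E i).PosSemidef) (hF : ∀ j, (F j).PosSemidef)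
    (h : ∀ i j, (P i j : ℂ) = ((E i) * (F j)).trace) :
    (∑ i, ⨆ j, P i j) ≤ (r : ℝ) := by
  have : Nonempty (Fin n) := ⟨⟨0, hn⟩⟩
  have hP : ∀ i j, P i j = (E i * F j).trace.re := fun i j => by
    rw [← h]; simp
  choose J hJ using fun i => exists_eq_ciSup_of_finite (f := fun j => P i j)
  simp only [← hJ]
  set S := ∑ i, E i with hS
  have hSp : S.PosSemidef := Matrix.posSemidef_sum _ fun i _ => hE i
  set K : ℝ := ∑ j, (F j).trace.re with hK
  have hK0 : 0 ≤ K := Finset.sum_nonneg fun j _ => aux_trace_nonneg (hF j)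
  have hSF : ∀ j, (S * F j).trace.re = 1 := fun j => by
    rw [hS, Matrix.sum_mul, Matrix.trace_sum, Complex.re_sum, ← hcol j]
    exact Finset.sum_congr rfl fun i _ => (hP i j).symm
  have key : ∀ ε : ℝ, 0 < ε → ∑ i, P i (J i) ≤ r * (1 + ε * K) := by
    intro ε hε
    set T : Matrix (Fin r) (Fin r) ℂ := S + (ε : ℂ) • (1 : Matrix (Fin r) (Fin r) ℂ) with hTd
    have hT : T.PosDef := by
      refine Matrix.PosDef.posSemidef_add hSp ?_
      exact Matrix.PosDef.smul Matrix.PosDef.one (by exact_mod_cast hε)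
    have hTF : ∀ j, (T * F j).trace.re ≤ 1 + ε * K := fun j => by
      rw [hTd, Matrix.add_mul, Matrix.trace_add, Complex.add_re, hSF]
      have : (F j).trace.re ≤ K :=
        Finset.single_le_sum (f := fun j => (F j).trace.re)
          (fun j _ => aux_trace_nonneg (hF j)) (Finset.mem_univ j)
      simp
      gcongr
    have hnn : ∀ i, 0 ≤ (T⁻¹ * E i).trace.re := fun i => by
      obtain ⟨C, hC⟩ := aux_exists (hE i)
      rw [hC, ← Matrix.mul_assoc, Matrix.trace_mul_comm, ← Matrix.mul_assoc]
      exact aux_trace_nonneg (hT.inv.posSemidef.mul_mul_conjTranspose_same C)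
    have hsum : ∑ i, (T⁻¹ * E i).trace.re ≤ r := by
      have e : ∑ i, (T⁻¹ * E i).trace.re = (T⁻¹ * S).trace.re := by
        rw [hS, Matrix.mul_sum, Matrix.trace_sum, Complex.re_sum]
      have e2 : T⁻¹ * S = 1 - (ε : ℂ) • T⁻¹ := by
        have : S = T - (ε : ℂ) • (1 : Matrix (Fin r) (Fin r) ℂ) := by simp [hTd]
        rw [this, Matrix.mul_sub, Matrix.nonsing_inv_mul _
          ((Matrix.isUnit_iff_isUnit_det _).1 hT.isUnit)]
        simp
      rw [e, e2]
      have := aux_trace_nonneg hT.inv.posSemidef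
      simp
      positivity
    calc ∑ i, P i (J i) ≤ ∑ i, (T⁻¹ * E i).trace.re * (1 + ε * K) := by
          refine Finset.sum_le_sum fun i _ => ?_
          rw [hP]
          exact (aux_trace_le hT (hE i) (hF _)).trans
            (mul_le_mul_of_nonneg_left (hTF _) (hnn i))
      _ = (∑ i, (T⁻¹ * E i).trace.re) * (1 + ε * K) := by rw [Finset.sum_mul]
      _ ≤ r * (1 + ε * K) := by gcongr
  refine le_of_forall_pos_le_add fun δ hδ => ?_
  have hd : (0 : ℝ) < r * K + 1 := by positivity
  refine (key (δ / (r * K + 1)) (by positivity)).trans ?_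
  have : δ / (r * K + 1) * (r * K) ≤ δ := by
    rw [div_mul_eq_mul_div, div_le_iff₀ hd]
    nlinarith
  nlinarith

end aux

/-- For a column-stochastic nonnegative matrix `P`,
`prank P ≥ ∑ i, max_j P i j`. -/
theorem prank_ge_sum_row_max {m n : ℕ}
    (P : Matrix (Fin m) (Fin n) ℝ) (hP : ∀ i j, 0 ≤ P i j)
    (hcol : ∀ j, ∑ i, P i j = 1) :
    (∑ i, ⨆ j, P i j) ≤ (prank P : ℝ) := by
  rcases Nat.eq_zero_or_pos n with rfl | hn
  · simp
  have hne : {r : ℕ |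
    ∃ (E : Fin m → Matrix (Fin r) (Fin r) ℂ) (F : Fin n → Matrix (Fin r) (Fin r) ℂ),
      (∀ i, (E i).PosSemidef) ∧ (∀ j, (F j).PosSemidef) ∧
      ∀ i j, (P i j : ℂ) = ((E i) * (F j)).trace}.Nonempty := by
    refine ⟨m, fun i => Matrix.diagonal (Pi.single i 1),
      fun j => Matrix.diagonal fun i => (P i j : ℂ), fun i => ?_, fun j => ?_, fun i j => ?_⟩
    · refine Matrix.PosSemidef.diagonal fun k => ?_
      by_cases hk : k = i
      · subst hk; simp
      · simp [hk]
    · refine Matrix.PosSemidef.diagonal fun k => ?_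
      simpa using hP k j
    · simp [Matrix.diagonal_mul_diagonal, Matrix.trace_diagonal, Pi.single_apply]
  obtain ⟨E, F, hE, hF, h⟩ := Nat.sInf_mem hne
  exact aux_main hn P hcol E F hE hF h
end

section
/- Let P be an m×n matrix with nonnegative real entries in which every column sums to 1, and for each row index i let q^{(i)} = (q^{(i)}_1,…,q^{(i)}_n) be a probability distribution on the columns. Then prank(P) ≥ ∑_{i=1}^m (∑_{k=1}^n q^{(i)}_k P(i,k)) / √(∑_{s=1}^n ∑_{t=1}^n q^{(i)}_s q^{(i)}_t F(P_s,P_t)²), where P_s denotes the s-th column of P. -/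
open scoped ComplexOrder

section
attribute [local instance] Matrix.frobeniusNormedAddCommGroup

theorem fr_sq {a b : ℕ} (X : Matrix (Fin a) (Fin b) ℂ) : ‖X‖ ^ 2 = ∑ i, ∑ j, ‖X i j‖ ^ 2 := by
  rw [Matrix.frobenius_norm_def, ← Real.sqrt_eq_rpow, Real.sq_sqrt (by positivity)]
  simp

theorem fr_sq_tr {a b : ℕ} (X : Matrix (Fin a) (Fin b) ℂ) :
    ((‖X‖ ^ 2 : ℝ) : ℂ) = (X.conjTranspose * X).trace := by
  rw [fr_sq, Finset.sum_comm]
  simp only [Matrix.trace, Matrix.diag, Matrix.mul_apply, Matrix.conjTranspose_apply]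
  push_cast
  refine Finset.sum_congr rfl fun i _ => Finset.sum_congr rfl fun j _ => ?_
  rw [← Complex.conj_mul']
  rfl

theorem fr_cs {r : ℕ} (X Y : Matrix (Fin r) (Fin r) ℂ) :
    ‖(X * Y).trace‖ ≤ ‖X‖ * ‖Y‖ := by
  have h1 : ‖(X * Y).trace‖ ≤ ∑ p : Fin r × Fin r, ‖X p.1 p.2‖ * ‖Y p.2 p.1‖ := by
    rw [Fintype.sum_prod_type]
    simp only [Matrix.trace, Matrix.diag, Matrix.mul_apply]
    refine (norm_sum_le _ _).trans (Finset.sum_le_sum fun i _ => (norm_sum_le _ _).trans ?_)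
    simp
  have h2 := Finset.sum_mul_sq_le_sq_mul_sq Finset.univ
    (fun p : Fin r × Fin r => ‖X p.1 p.2‖) (fun p => ‖Y p.2 p.1‖)
  have hX : ∑ p : Fin r × Fin r, ‖X p.1 p.2‖ ^ 2 = ‖X‖ ^ 2 := by
    rw [fr_sq, Fintype.sum_prod_type]
  have hY : ∑ p : Fin r × Fin r, ‖Y p.2 p.1‖ ^ 2 = ‖Y‖ ^ 2 := by
    rw [fr_sq, Fintype.sum_prod_type, Finset.sum_comm]
  rw [hX, hY, ← mul_pow] at h2
  exact h1.trans (le_of_sq_le_sq h2 (by positivity))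

theorem pinv {r : ℕ} (S : Matrix (Fin r) (Fin r) ℂ) (hS : S.PosSemidef) :
    ∃ T R : Matrix (Fin r) (Fin r) ℂ, T.conjTranspose = T ∧ R.conjTranspose = R ∧
      T * T = S ∧ T * R = R * T ∧ T * R * T = T ∧ (T * R).trace.re ≤ r := by
  have hH := hS.1
  obtain ⟨U, hU⟩ : ∃ U : Matrix (Fin r) (Fin r) ℂ, U = hH.eigenvectorUnitary.1 := ⟨_, rfl⟩
  have hUU : star U * U = 1 := by
    rw [hU]; exact (Matrix.mem_unitaryGroup_iff'.1 hH.eigenvectorUnitary.2)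
  have hsp := hH.spectral_theorem
  rw [Unitary.conjStarAlgAut_apply] at hsp
  rw [← hU] at hsp
  set l := hH.eigenvalues
  have hl : ∀ i, 0 ≤ l i := hS.eigenvalues_nonneg
  let G : (Fin r → ℝ) → Matrix (Fin r) (Fin r) ℂ :=
    fun f => U * Matrix.diagonal (fun i => (f i : ℂ)) * star U
  have hGm : ∀ f g, G f * G g = G (fun i => f i * g i) := by
    intro f g
    simp only [G]
    calc _ = U * Matrix.diagonal (fun i => (f i : ℂ)) * (star U * U) * Matrix.diagonal (fun i => (g i : ℂ)) * star U := by
          simp only [Matrix.mul_assoc]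
      _ = _ := by
          rw [hUU, Matrix.mul_one, Matrix.mul_assoc U, Matrix.diagonal_mul_diagonal]
          simp
  have hGs : ∀ f, (G f).conjTranspose = G f := by
    intro f
    simp only [G, Matrix.star_eq_conjTranspose, Matrix.conjTranspose_mul, Matrix.conjTranspose_conjTranspose,
      Matrix.diagonal_conjTranspose, Matrix.mul_assoc]
    congr 3
    ext i
    simp
  have hGt : ∀ f, (G f).trace = ((∑ i, f i : ℝ) : ℂ) := by
    intro f
    simp only [G]
    rw [Matrix.trace_mul_comm, ← Matrix.mul_assoc, hUU, Matrix.one_mul, Matrix.trace_diagonal]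
    simp
  refine ⟨G fun i => √(l i), G fun i => (√(l i))⁻¹, hGs _, hGs _, ?_, ?_, ?_, ?_⟩
  · rw [hGm]
    simp only [Real.mul_self_sqrt (hl _)]
    exact hsp.symm
  · rw [hGm, hGm]; simp only [mul_comm]
  · rw [hGm, hGm]
    congr 1; ext i
    by_cases h : √(l i) = 0
    · simp [h]
    · field_simp
  · rw [hGm, hGt, Complex.ofReal_re]
    calc _ ≤ ∑ i : Fin r, (1:ℝ) := Finset.sum_le_sum fun i _ => mul_inv_le_one
      _ = r := by simp

theorem main_aux {m n r : ℕ}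
    (P : Matrix (Fin m) (Fin n) ℝ)
    (q : Fin m → Fin n → ℝ) (hq : ∀ i k, 0 ≤ q i k) 
    (A : Fin m → Matrix (Fin r) (Fin r) ℂ) (B : Fin n → Matrix (Fin r) (Fin r) ℂ)
    (hPA : ∀ i j, P i j = ‖A i * B j‖ ^ 2) :
    ∑ i, (∑ k, q i k * P i k) /
        Real.sqrt (∑ s, ∑ t, q i s * q i t * (∑ u, Real.sqrt (P u s * P u t)) ^ 2)
      ≤ (r : ℝ) := by
  set S := ∑ i, (A i).conjTranspose * A i with hSdef
  have hS : S.PosSemidef := Matrix.posSemidef_sum _ fun i _ => Matrix.posSemidef_conjTranspose_mul_self _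
  obtain ⟨T, R, hT, hR, hTT, hTR, hTRT, htr⟩ := pinv S hS
  -- kernel
  have hA : ∀ i, A i * (T * R) = A i := by
    have h0 : ∑ i, ‖A i * (1 - T * R)‖ ^ 2 = 0 := by
      have : ((∑ i, ‖A i * (1 - T * R)‖ ^ 2 : ℝ) : ℂ) = 0 := by
        rw [Complex.ofReal_sum]
        simp only [fr_sq_tr, Matrix.conjTranspose_mul]
        rw [← Matrix.trace_sum]
        have : ∑ i, (1 - T * R).conjTranspose * (A i).conjTranspose * (A i * (1 - T * R))
            = (1 - T * R).conjTranspose * (S * (1 - T * R)) := by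
          rw [hSdef, Finset.sum_mul, Finset.mul_sum]
          simp only [Matrix.mul_assoc]
        rw [this]
        have : S * (1 - T * R) = 0 := by
          rw [← hTT, mul_sub, mul_one, hTR, mul_assoc, ← mul_assoc T R T, hTRT, sub_self]
        rw [this]; simp
      exact_mod_cast this
    intro i
    rw [Finset.sum_eq_zero_iff_of_nonneg (fun _ _ => by positivity)] at h0
    have := h0 i (Finset.mem_univ _)
    have h1 : A i * (1 - T * R) = 0 := norm_eq_zero.1 (by simpa using this)
    rw [mul_sub, mul_one, sub_eq_zero] at h1
    exact h1.symm
  have hsum : ∑ i, ‖A i * R‖ ^ 2 ≤ (r : ℝ) := by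
    have : ((∑ i, ‖A i * R‖ ^ 2 : ℝ) : ℂ) = (T * R).trace := by
      rw [Complex.ofReal_sum]
      simp only [fr_sq_tr, Matrix.conjTranspose_mul, hR]
      rw [← Matrix.trace_sum]
      have : ∑ i, R * (A i).conjTranspose * (A i * R) = R * (S * R) := by
        rw [hSdef, Finset.sum_mul, Finset.mul_sum]
        simp only [Matrix.mul_assoc]
      rw [this, ← hTT, mul_assoc T T R, hTR, ← mul_assoc T R T, hTRT, ← hTR]
    have h2 := congrArg Complex.re this
    rw [Complex.ofReal_re] at h2
    rw [h2]; exact htr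
  refine le_trans (Finset.sum_le_sum fun i _ => ?_) hsum
  refine div_le_of_le_mul₀ (Real.sqrt_nonneg _) (by positivity) ?_
  set M : Matrix (Fin r) (Fin r) ℂ := ∑ k, ((q i k : ℝ) : ℂ) • (T * B k * (T * B k).conjTranspose) with hM
  have hMH : M.conjTranspose = M := by
    rw [hM, Matrix.conjTranspose_sum]
    refine Finset.sum_congr rfl fun k _ => ?_
    rw [Matrix.conjTranspose_smul, Matrix.conjTranspose_mul, Matrix.conjTranspose_conjTranspose]
    simp
  have hnum : ((∑ k, q i k * P i k : ℝ) : ℂ) = ((A i * R).conjTranspose * (A i * R) * M).trace := by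
    rw [hM, Finset.mul_sum, Matrix.trace_sum, Complex.ofReal_sum]
    refine Finset.sum_congr rfl fun k _ => ?_
    rw [Matrix.mul_smul, Matrix.trace_smul, Complex.ofReal_mul, smul_eq_mul, hPA, fr_sq_tr]
    congr 1
    have : A i * B k = A i * R * (T * B k) := by
      conv_lhs => rw [← hA i, hTR]
      simp only [mul_assoc]
    rw [this, Matrix.conjTranspose_mul (A i * R), mul_assoc, Matrix.trace_mul_comm]
    simp only [mul_assoc]
  have hle : ∑ k, q i k * P i k ≤ ‖A i * R‖ ^ 2 * ‖M‖ := by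
    have h1 := fr_cs ((A i * R).conjTranspose * (A i * R)) M
    rw [← hnum, Complex.norm_real] at h1
    have h2 : ‖(A i * R).conjTranspose * (A i * R)‖ ≤ ‖A i * R‖ ^ 2 := by
      refine (Matrix.frobenius_norm_mul _ _).trans ?_
      rw [Matrix.frobenius_norm_conjTranspose, sq]
    exact (le_abs_self _).trans (h1.trans (by gcongr))
  refine hle.trans ?_
  gcongr
  refine Real.le_sqrt_of_sq_le ?_
  have hMsq : ‖M‖ ^ 2 = ∑ s, ∑ t, q i s * q i t * ‖(T * B s).conjTranspose * (T * B t)‖ ^ 2 := by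
    have : ((‖M‖ ^ 2 : ℝ) : ℂ) = ((∑ s, ∑ t, q i s * q i t * ‖(T * B s).conjTranspose * (T * B t)‖ ^ 2 : ℝ) : ℂ) := by
      rw [fr_sq_tr, hMH]
      rw [hM, Finset.sum_mul, Matrix.trace_sum, Complex.ofReal_sum]
      refine Finset.sum_congr rfl fun s _ => ?_
      rw [Finset.mul_sum, Matrix.trace_sum, Complex.ofReal_sum]
      refine Finset.sum_congr rfl fun t _ => ?_
      rw [Complex.ofReal_mul, fr_sq_tr, Matrix.smul_mul, Matrix.mul_smul, smul_smul,
        Matrix.trace_smul, smul_eq_mul, Complex.ofReal_mul]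
      congr 1
      rw [Matrix.conjTranspose_mul (T * B s).conjTranspose, Matrix.conjTranspose_conjTranspose,
        ← mul_assoc, Matrix.trace_mul_comm, ← mul_assoc, ← mul_assoc, Matrix.trace_mul_comm]
      simp only [mul_assoc]
      rw [Matrix.trace_mul_comm]
      simp only [mul_assoc]
    exact_mod_cast this
  rw [hMsq]
  refine Finset.sum_le_sum fun s _ => Finset.sum_le_sum fun t _ => ?_
  refine mul_le_mul_of_nonneg_left ?_ (mul_nonneg (hq _ _) (hq _ _))
  refine pow_le_pow_left₀ (norm_nonneg _) ?_ 2
  have : (T * B s).conjTranspose * (T * B t) = ∑ u, (A u * B s).conjTranspose * (A u * B t) := by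
    calc _ = (B s).conjTranspose * (S * B t) := by
          rw [Matrix.conjTranspose_mul, hT, ← hTT]; simp only [mul_assoc]
      _ = _ := by
          rw [hSdef, Finset.sum_mul, Finset.mul_sum]
          simp only [Matrix.conjTranspose_mul, mul_assoc]
  rw [this]
  refine (norm_sum_le _ _).trans (Finset.sum_le_sum fun u _ => ?_)
  refine (Matrix.frobenius_norm_mul _ _).trans ?_
  rw [Matrix.frobenius_norm_conjTranspose, hPA, hPA, ← mul_pow, Real.sqrt_sq (by positivity)]

theorem main_aux2 {m n r : ℕ}
    (P : Matrix (Fin m) (Fin n) ℝ)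
    (q : Fin m → Fin n → ℝ) (hq : ∀ i k, 0 ≤ q i k) 
    (E : Fin m → Matrix (Fin r) (Fin r) ℂ) (F : Fin n → Matrix (Fin r) (Fin r) ℂ)
    (hE : ∀ i, (E i).PosSemidef) (hF : ∀ j, (F j).PosSemidef)
    (hPA : ∀ i j, (P i j : ℂ) = (E i * F j).trace) :
    ∑ i, (∑ k, q i k * P i k) /
        Real.sqrt (∑ s, ∑ t, q i s * q i t * (∑ u, Real.sqrt (P u s * P u t)) ^ 2)
      ≤ (r : ℝ) := by
  have hfac : ∀ X : Matrix (Fin r) (Fin r) ℂ, X.PosSemidef → ∃ Y, X = Y.conjTranspose * Y := by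
    intro X hX
    obtain ⟨T, R, hT, -, hTT, -⟩ := pinv X hX
    exact ⟨T, by rw [hT, hTT]⟩
  choose A hA using fun i => hfac _ (hE i)
  choose B hB using fun j => hfac _ (hF j)
  refine main_aux P q hq A (fun j => (B j).conjTranspose) fun i j => ?_
  have : (P i j : ℂ) = ((‖A i * (B j).conjTranspose‖ ^ 2 : ℝ) : ℂ) := by
    rw [hPA, fr_sq_tr, hA, hB, Matrix.conjTranspose_mul, Matrix.conjTranspose_conjTranspose,
      mul_assoc (B j), Matrix.trace_mul_comm (B j)]
    simp only [mul_assoc]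
  exact_mod_cast this
end

/-- The `B₅` lower bound: for a column-stochastic nonnegative matrix `P` and, for each
row `i`, a probability distribution `q i` over the columns,
`prank P ≥ ∑ i, (∑ k, q i k * P i k) / √(∑_{s,t} q i s * q i t * F(P_s, P_t)²)`,
where `F(P_s, P_t) = ∑_u √(P u s * P u t)`. -/
theorem prank_B5_lower_bound {m n : ℕ}
    (P : Matrix (Fin m) (Fin n) ℝ) (hP : ∀ i j, 0 ≤ P i j)
    (hcol : ∀ j, ∑ i, P i j = 1)
    (q : Fin m → Fin n → ℝ) (hq : ∀ i k, 0 ≤ q i k) (hq1 : ∀ i, ∑ k, q i k = 1) :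
    ∑ i, (∑ k, q i k * P i k) /
        Real.sqrt (∑ s, ∑ t, q i s * q i t * (∑ u, Real.sqrt (P u s * P u t)) ^ 2)
      ≤ (prank P : ℝ) := by
  have hne : {r : ℕ |
    ∃ (E : Fin m → Matrix (Fin r) (Fin r) ℂ) (F : Fin n → Matrix (Fin r) (Fin r) ℂ),
      (∀ i, (E i).PosSemidef) ∧ (∀ j, (F j).PosSemidef) ∧
      ∀ i j, (P i j : ℂ) = ((E i) * (F j)).trace}.Nonempty := by
    refine ⟨n, fun i => Matrix.diagonal fun k => (P i k : ℂ),
      fun j => Matrix.diagonal fun k => if k = j then 1 else 0, ?_, ?_, ?_⟩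
    · intro i
      exact Matrix.PosSemidef.diagonal fun k => by simpa using hP i k
    · intro j
      refine Matrix.PosSemidef.diagonal fun k => ?_
      by_cases h : k = j <;> simp [h]
    · intro i j
      rw [Matrix.diagonal_mul_diagonal, Matrix.trace_diagonal]
      simp
  obtain ⟨E, F, hE, hF, h⟩ := Nat.sInf_mem hne
  exact main_aux2 P q hq E F hE hF h
end

section
/- Let n be an odd positive integer. Then there exist n² complex Hermitian n×n matrices G_{ij}, indexed by i, j ∈ {0,…,n−1}, such that: (1) Tr(G_{ij}) = Tr(G_{kl}) for all i, j, k, l; (2) Tr(G_{ij} G_{kl}) = n if (i,j) = (k,l) and 0 otherwise; and (3) G_{ij}² = I_n for all i, j. -/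
theorem aux_zmod {n : ℕ} [NeZero n] (hn : Odd n) :
    ∃ G : ZMod n → ZMod n → Matrix (ZMod n) (ZMod n) ℂ,
      (∀ i j, (G i j).IsHermitian) ∧
      (∀ i j k l, (G i j).trace = (G k l).trace) ∧
      (∀ i j k l, (G i j * G k l).trace = if i = k ∧ j = l then (n : ℂ) else 0) ∧
      (∀ i j, G i j * G i j = 1) := by
  have h2 : IsUnit (2 : ZMod n) := by
    have := (ZMod.isUnit_iff_coprime 2 n).2 (Nat.coprime_two_left.2 hn)
    exact_mod_cast this
  obtain ⟨u, hu⟩ := h2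
  have hinv : (2 : ZMod n) * (↑u⁻¹ : ZMod n) = 1 := by rw [← hu]; simp
  have mulG : ∀ (i j k l x z : ZMod n),
      ∑ y, (if x + y = i then ZMod.stdAddChar (j * (x - y)) else (0 : ℂ)) *
        (if y + z = k then ZMod.stdAddChar (l * (y - z)) else (0 : ℂ)) =
      if i - x + z = k then
        ZMod.stdAddChar (j * (x - (i - x)) + l * (i - x - z)) else (0 : ℂ) := by
    intro i j k l x z
    rw [Finset.sum_eq_single (i - x)]
    · simp [AddChar.map_add_eq_mul]
    · intro y _ hy
      rw [if_neg, zero_mul]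
      intro h
      exact hy (by rw [← h]; ring)
    · simp
  refine ⟨fun i j => Matrix.of fun x y => if x + y = i then ZMod.stdAddChar (j * (x - y)) else 0,
    ?_, ?_, ?_, ?_⟩
  · intro i j
    ext x y
    simp only [Matrix.conjTranspose_apply, Matrix.of_apply, add_comm y x]
    split_ifs
    · rw [← starRingEnd_apply, ← AddChar.map_neg_eq_conj]
      congr 1; ring
    · simp
  · have key : ∀ i j : ZMod n, (Matrix.of fun x y : ZMod n =>
        if x + y = i then ZMod.stdAddChar (j * (x - y)) else (0 : ℂ)).trace = 1 := by
      intro i j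
      simp only [Matrix.trace, Matrix.diag_apply, Matrix.of_apply]
      rw [Finset.sum_eq_single (↑u⁻¹ * i)]
      · rw [if_pos]
        · simp
        · linear_combination i * hinv
      · intro y _ hy
        rw [if_neg]
        intro h
        apply hy
        linear_combination (↑u⁻¹ : ZMod n) * h - y * hinv
      · simp
    intro i j k l
    rw [key, key]
  · intro i j k l
    simp only [Matrix.trace, Matrix.diag_apply, Matrix.mul_apply, Matrix.of_apply, mulG]
    by_cases hik : i = k
    · subst hik
      simp only [sub_add_cancel, if_true, true_and]
      have hs := AddChar.sum_mulShift (2 * (j - l)) (ZMod.isPrimitive_stdAddChar n)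
      have h0 : 2 * (j - l) = 0 ↔ j = l := by
        rw [← hu, Units.mul_right_eq_zero, sub_eq_zero]
      simp only [h0, ZMod.card] at hs
      have : ∀ x : ZMod n, (ZMod.stdAddChar (j * (x - (i - x)) + l * (i - x - x)) : ℂ) =
          ZMod.stdAddChar (x * (2 * (j - l))) * ZMod.stdAddChar (-(i * (j - l))) := by
        intro x
        rw [← AddChar.map_add_eq_mul]
        congr 1; ring
      simp only [this]
      rw [← Finset.sum_mul, hs]
      split_ifs with h
      · simp [h]
      · simp
    · simp [hik]
  · intro i j
    ext x z
    simp only [Matrix.mul_apply, Matrix.of_apply, mulG, Matrix.one_apply]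
    by_cases h : x = z
    · subst h
      rw [if_pos (by ring), if_pos rfl, ← AddChar.map_zero_eq_one (ZMod.stdAddChar (N := n))]
      congr 1; ring
    · rw [if_neg h, if_neg]
      intro h'
      apply h
      linear_combination -h'

/-- For odd `n`, there are `n²` Hermitian `n × n` matrices `G i j` with equal traces,
`Tr (G i j * G k l) = n·δ_{ik}δ_{jl}`, and `(G i j)² = 1`. -/
theorem exists_hermitian_family_odd {n : ℕ} (hn : Odd n) (hpos : 0 < n) :
    ∃ G : Fin n → Fin n → Matrix (Fin n) (Fin n) ℂ,
      (∀ i j, (G i j).IsHermitian) ∧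
      (∀ i j k l, (G i j).trace = (G k l).trace) ∧
      (∀ i j k l, (G i j * G k l).trace = if i = k ∧ j = l then (n : ℂ) else 0) ∧
      (∀ i j, G i j * G i j = 1) := by
  cases n with
  | zero => exact absurd hpos (lt_irrefl 0)
  | succ m => exact aux_zmod hn
end

section
/- Let n be an odd positive integer and let A be the n²×n² nonequality matrix, i.e. A(i,i) = 0 for all i and A(i,j) = 1 for all i ≠ j. Then prank(A) ≤ n. -/
open scoped ComplexOrder

open Matrix in
/-- Displaced parity (phase point) operators. -/
noncomputable def phasePt {n : ℕ} [NeZero n] (u : ZMod n × ZMod n) :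
    Matrix (ZMod n) (ZMod n) ℂ :=
  Matrix.of fun x y => if x + y = u.1 then ZMod.stdAddChar (u.2 * (x - y)) else 0

theorem phasePt_herm {n : ℕ} [NeZero n] (u : ZMod n × ZMod n) :
    (phasePt u).conjTranspose = phasePt u := by
  ext x y
  simp only [phasePt, Matrix.conjTranspose_apply, Matrix.of_apply, add_comm y x]
  split_ifs
  · rw [← starRingEnd_apply, ← AddChar.map_neg_eq_conj]
    congr 1
    ring
  · simp

theorem phasePt_sq {n : ℕ} [NeZero n] (u : ZMod n × ZMod n) :
    phasePt u * phasePt u = 1 := by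
  ext x z
  simp only [phasePt, Matrix.mul_apply, Matrix.of_apply]
  rw [Finset.sum_eq_single (u.1 - x)]
  · rw [if_pos (by ring), Matrix.one_apply]
    by_cases h : x = z
    · subst h
      rw [if_pos (by ring), if_pos rfl, ← AddChar.map_add_eq_mul]
      rw [← AddChar.map_zero_eq_one (ZMod.stdAddChar (N := n))]
      congr 1
      ring
    · rw [if_neg h, if_neg, mul_zero]
      intro h'
      apply h
      linear_combination -h'
  · intro y _ hy
    rw [if_neg, zero_mul]
    intro h
    apply hy
    rw [← h]; ring
  · simp

theorem two_unit {n : ℕ} (hn : Odd n) : ∃ t : ZMod n, t * 2 = 1 := by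
  have h : IsUnit ((2 : ℕ) : ZMod n) := by
    rw [ZMod.isUnit_iff_coprime]
    exact (Nat.coprime_two_left).2 hn
  obtain ⟨t, ht⟩ := h.exists_left_inv
  exact ⟨t, by exact_mod_cast ht⟩

theorem phasePt_trace {n : ℕ} [NeZero n] (hn : Odd n) (u : ZMod n × ZMod n) :
    (phasePt u).trace = 1 := by
  obtain ⟨t, ht⟩ := two_unit hn
  simp only [phasePt, Matrix.trace, Matrix.diag_apply, Matrix.of_apply]
  rw [Finset.sum_eq_single (t * u.1)]
  · rw [if_pos (by linear_combination u.1 * ht)]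
    simp
  · intro y _ hy
    rw [if_neg]
    intro h
    apply hy
    linear_combination t * h - y * ht
  · simp

theorem phasePt_trace_mul {n : ℕ} [NeZero n] (hn : Odd n) (u v : ZMod n × ZMod n) :
    (phasePt u * phasePt v).trace = if u = v then (n : ℂ) else 0 := by
  obtain ⟨t, ht⟩ := two_unit hn
  have key : (phasePt u * phasePt v).trace = ∑ x : ZMod n,
      if u.1 = v.1 then ZMod.stdAddChar ((u.2 - v.2) * (2 * x - u.1)) else 0 := by
    simp only [phasePt, Matrix.trace, Matrix.diag_apply, Matrix.of_apply, Matrix.mul_apply]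
    refine Finset.sum_congr rfl fun x _ => ?_
    rw [Finset.sum_eq_single (u.1 - x)]
    · rw [if_pos (by ring), show u.1 - x + x = u.1 by ring]
      split_ifs
      · rw [← AddChar.map_add_eq_mul]
        congr 1
        ring
      · simp
    · intro y _ hy
      rw [if_neg, zero_mul]
      intro h
      apply hy
      rw [← h]; ring
    · simp
  rw [key]
  by_cases h1 : u.1 = v.1
  · simp only [if_pos h1]
    have h2 : ∀ x : ZMod n, (ZMod.stdAddChar ((u.2 - v.2) * (2 * x - u.1)) : ℂ) =
        ZMod.stdAddChar (-((u.2 - v.2) * u.1)) *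
          ZMod.stdAddChar (x * (2 * (u.2 - v.2))) := by
      intro x
      rw [← AddChar.map_add_eq_mul]
      congr 1
      ring
    simp only [h2]
    rw [← Finset.mul_sum, AddChar.sum_mulShift _ (ZMod.isPrimitive_stdAddChar n)]
    by_cases h3 : u.2 = v.2
    · rw [if_pos (Prod.ext h1 h3)]
      simp [h3, ZMod.card]
    · rw [if_neg, if_neg]
      · simp
      · intro h; exact h3 (by rw [h])
      · intro h
        apply h3
        linear_combination t * h - (u.2 - v.2) * ht
  · rw [if_neg (fun h => h1 (by rw [h]))]
    simp [h1]

theorem psd_of_sq {ι : Type*} [Fintype ι] [DecidableEq ι] (P : Matrix ι ι ℂ)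
    (h : P.conjTranspose = P) (h2 : P * P = (2 : ℂ) • P) : P.PosSemidef := by
  have h3 : ((1 / 2 : ℂ) • (P.conjTranspose * P)).PosSemidef :=
    (Matrix.posSemidef_conjTranspose_mul_self P).smul (by
      rw [Complex.le_def]; norm_num)
  rw [h, h2, smul_smul] at h3
  simpa using h3

/-- For odd `n`, the nonequality matrix of size `n²` has PSD-rank at most `n`. -/
theorem prank_nonequality_odd {n : ℕ} (hn : Odd n) (hpos : 0 < n)
    (A : Matrix (Fin (n ^ 2)) (Fin (n ^ 2)) ℝ)
    (hA : ∀ i j, A i j = if i = j then 0 else 1) :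
    prank A ≤ n := by
  haveI : NeZero n := ⟨hpos.ne'⟩
  have hn0 : (n : ℂ) ≠ 0 := Nat.cast_ne_zero.2 hpos.ne'
  let e : Fin n ≃ ZMod n := Fintype.equivOfCardEq (by simp [ZMod.card])
  let f : Fin (n ^ 2) ≃ ZMod n × ZMod n :=
    Fintype.equivOfCardEq (by simp [ZMod.card, sq])
  apply Nat.sInf_le
  refine ⟨fun i => ((1 / n : ℂ) • (1 - phasePt (f i))).submatrix e e,
    fun j => (1 + phasePt (f j)).submatrix e e, ?_, ?_, ?_⟩
  · intro i
    refine Matrix.PosSemidef.submatrix (Matrix.PosSemidef.smul (psd_of_sq _ ?_ ?_) ?_) e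
    · simp [phasePt_herm]
    · rw [sub_mul, mul_sub, mul_sub, phasePt_sq, two_smul]
      simp only [mul_one, one_mul]
      abel
    · have : (0 : ℂ) ≤ ((1 / n : ℝ) : ℂ) := by
        rw [Complex.zero_le_real]; positivity
      simpa using this
  · intro i
    refine Matrix.PosSemidef.submatrix (psd_of_sq _ ?_ ?_) e
    · simp [phasePt_herm]
    · rw [add_mul, mul_add, mul_add, phasePt_sq, two_smul]
      simp only [mul_one, one_mul]
      abel
  · intro i j
    rw [Matrix.submatrix_mul_equiv, hA]
    have ht : ∀ M : Matrix (ZMod n) (ZMod n) ℂ, (M.submatrix e e).trace = M.trace := by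
      intro M
      exact Equiv.sum_comp e (fun x => M x x)
    rw [ht, smul_mul_assoc, Matrix.trace_smul, sub_mul, mul_add, mul_add]
    simp only [mul_one, one_mul, Matrix.trace_sub, Matrix.trace_add, phasePt_trace hn,
      phasePt_trace_mul hn, Matrix.trace_one, ZMod.card, f.injective.eq_iff]
    split_ifs
    · simp [add_comm]
    · simp [hn0]
end

section
/- Let n be an even positive integer and let A be the (n²−1)×(n²−1) nonequality matrix, i.e. A(i,i) = 0 for all i and A(i,j) = 1 for all i ≠ j. Then prank(A) ≤ n. -/
open scoped ComplexOrder

namespace PrankAux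

open Matrix

/-- elementary antidiagonal matrices -/
noncomputable def R (N : ℕ) (z : ℂ) (a : Fin N) : Matrix (Fin N) (Fin N) ℂ :=
  fun i j => if i.rev = j then z ^ (((a : ℕ) : ℤ) * (((i : ℕ) : ℤ) - ((j : ℕ) : ℤ))) else 0

theorem R_herm {N : ℕ} {z : ℂ} (hz : star z = z⁻¹) (a : Fin N) : (R N z a)ᴴ = R N z a := by
  ext i j
  simp only [conjTranspose_apply, R]
  have h : j.rev = i ↔ i.rev = j := by
    constructor <;> (rintro rfl; simp)
  simp only [h]
  split_ifs
  · rw [star_zpow₀, hz, _root_.inv_zpow', ← mul_neg, neg_sub]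
  · simp

theorem R_sq {N : ℕ} {z : ℂ} (hz : z ≠ 0) (a : Fin N) : R N z a * R N z a = 1 := by
  ext i j
  simp only [mul_apply, R, ite_mul, zero_mul, Finset.sum_ite_eq, Finset.mem_univ, if_true,
    Fin.rev_rev, one_apply]
  split_ifs with h
  · subst h
    rw [← zpow_add₀ hz, ← mul_add]
    simp
  · simp

theorem R_trace {N : ℕ} {z : ℂ} (hp : IsPrimitiveRoot z (2 * N)) (hN : 0 < N) (a b : Fin N)
    (hab : a ≠ b) : (R N z a * R N z b).trace = 0 := by
  have hz : z ≠ 0 := hp.ne_zero (by omega)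
  simp only [trace, diag_apply, mul_apply, R, ite_mul, zero_mul, Finset.sum_ite_eq,
    Finset.mem_univ, if_true, Fin.rev_rev]
  set d : ℤ := ((a : ℕ) : ℤ) - ((b : ℕ) : ℤ) with hd
  have h1 : ∀ i : Fin N, z ^ (((a : ℕ) : ℤ) * (((i : ℕ) : ℤ) - ((i.rev : ℕ) : ℤ))) *
      z ^ (((b : ℕ) : ℤ) * (((i.rev : ℕ) : ℤ) - ((i : ℕ) : ℤ))) =
      z ^ (-(d * (N - 1))) * (z ^ (2 * d)) ^ (i : ℕ) := by
    intro i
    rw [← zpow_add₀ hz, ← zpow_natCast, ← _root_.zpow_mul, ← zpow_add₀ hz]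
    congr 1
    have : ((i.rev : ℕ) : ℤ) = N - 1 - (i : ℕ) := by
      rw [Fin.val_rev]; have := i.2; omega
    rw [this, hd]; ring
  simp only [h1]
  rw [← Finset.mul_sum, Fin.sum_univ_eq_sum_range (fun i => (z ^ (2 * d)) ^ i) N]
  have h2 : z ^ (2 * d) ≠ 1 := by
    intro h
    rw [hp.zpow_eq_one_iff_dvd] at h
    push_cast at h
    have h3 : (N : ℤ) ∣ d := by
      obtain ⟨c, hc⟩ := h
      exact ⟨c, by linarith [mul_assoc (2:ℤ) N c]⟩
    have h4 : d = 0 := by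
      apply Int.eq_zero_of_abs_lt_dvd h3
      have := a.2; have := b.2
      rw [abs_lt]; omega
    apply hab; ext; omega
  have h3 : (z ^ (2 * d)) ^ N = 1 := by
    rw [← zpow_natCast, ← _root_.zpow_mul, hp.zpow_eq_one_iff_dvd]
    exact ⟨d, by push_cast; ring⟩
  have h4 := geom_sum_mul (z ^ (2 * d)) N
  rw [h3, sub_self] at h4
  rw [(mul_eq_zero.mp h4).resolve_right (sub_ne_zero.mpr h2), mul_zero]

/-- relabelling -/
def p (q : ℕ) (k : ZMod (2 * q + 1)) : Option (ZMod (2 * q + 1)) ≃ Fin (2 * q + 1 + 1) :=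
  (Equiv.optionCongr (Equiv.subRight k)).trans
    (finSuccEquivLast (n := 2 * q + 1)).symm

theorem p_none (q : ℕ) (k : ZMod (2 * q + 1)) : ((p q k none : Fin _) : ℕ) = 2 * q + 1 := by
  change (((finSuccEquivLast (n := 2 * q + 1)).symm none : Fin _) : ℕ) = 2 * q + 1
  simp

theorem p_some (q : ℕ) (k x : ZMod (2 * q + 1)) :
    ((p q k (some x) : Fin _) : ℕ) = (x - k).val := by
  change (((finSuccEquivLast (n := 2 * q + 1)).symm (some (x - k : ZMod (2 * q + 1)))
    : Fin _) : ℕ) = (x - k).val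
  erw [finSuccEquivLast_symm_some]
  rfl

theorem p_sep (q : ℕ) (k l : ZMod (2 * q + 1)) (x y)
    (hk : (p q k x).rev = p q k y) (hl : (p q l x).rev = p q l y) : k = l := by
  have key : ∀ k, (p q k x).rev = p q k y →
      ((p q k x : ℕ) + (p q k y : ℕ) = 2 * q + 1) := by
    intro k h
    rw [← h, Fin.val_rev]; have := (p q k x).2; omega
  have hk := key k hk
  have hl := key l hl
  rcases x with _ | x <;> rcases y with _ | y
  · rw [p_none] at hk; omega
  · rw [p_none, p_some] at hk hl
    have h1 : (y - k).val = 0 := by omega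
    have h2 : (y - l).val = 0 := by omega
    rw [ZMod.val_eq_zero, sub_eq_zero] at h1 h2
    rw [← h1, ← h2]
  · rw [p_none, p_some] at hk hl
    have h1 : (x - k).val = 0 := by omega
    have h2 : (x - l).val = 0 := by omega
    rw [ZMod.val_eq_zero, sub_eq_zero] at h1 h2
    rw [← h1, ← h2]
  · rw [p_some, p_some] at hk hl
    have h0 : ((2 * q + 1 : ℕ) : ZMod (2 * q + 1)) = 0 := ZMod.natCast_self _
    have h1 := congrArg (Nat.cast : ℕ → ZMod (2 * q + 1)) hk
    have h2 := congrArg (Nat.cast : ℕ → ZMod (2 * q + 1)) hl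
    rw [h0, Nat.cast_add, ZMod.natCast_zmod_val, ZMod.natCast_zmod_val] at h1 h2
    push_cast at h0
    linear_combination (q + 1 : ZMod (2 * q + 1)) * (h2 - h1) + (l - k) * h0

/-- Hermitian unitaries -/
noncomputable def H (q : ℕ) (z : ℂ) (s : ZMod (2 * q + 1) × Fin (2 * q + 1 + 1)) :
    Matrix (Option (ZMod (2 * q + 1))) (Option (ZMod (2 * q + 1))) ℂ :=
  (R (2 * q + 1 + 1) z s.2).submatrix (p q s.1) (p q s.1)

theorem H_diag (q : ℕ) (z : ℂ) (s) (x) : H q z s x x = 0 := by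
  simp only [H, submatrix_apply, R]
  rw [if_neg]
  intro h
  have := congrArg Fin.val h
  rw [Fin.val_rev] at this
  have := (p q s.1 x).2
  omega

theorem H_herm {q : ℕ} {z : ℂ} (hz : star z = z⁻¹) (s) : (H q z s)ᴴ = H q z s := by
  rw [H, conjTranspose_submatrix, R_herm hz]

theorem H_sq {q : ℕ} {z : ℂ} (hz : z ≠ 0) (s) : H q z s * H q z s = 1 := by
  rw [H, submatrix_mul_equiv, R_sq hz, submatrix_one_equiv]

theorem H_tr {q : ℕ} {z : ℂ} (s) : (H q z s).trace = 0 := by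
  simp [trace, H_diag]

theorem H_orth {q : ℕ} {z : ℂ} (hp : IsPrimitiveRoot z (2 * (2 * q + 1 + 1))) (s t)
    (hst : s ≠ t) : (H q z s * H q z t).trace = 0 := by
  obtain ⟨k, a⟩ := s
  obtain ⟨l, b⟩ := t
  by_cases hkl : k = l
  · subst hkl
    have hab : a ≠ b := fun h => hst (by rw [h])
    simp only [H]
    rw [submatrix_mul_equiv]
    have := R_trace hp (by omega) a b hab
    rw [← this]
    simp only [trace, diag_apply, submatrix_apply]
    exact Equiv.sum_comp (p q k) (fun i => (R _ z a * R _ z b) i i)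
  · simp only [trace, diag_apply, mul_apply]
    refine Finset.sum_eq_zero fun x _ => Finset.sum_eq_zero fun y _ => ?_
    simp only [H, submatrix_apply, R]
    by_cases h1 : (p q k x).rev = p q k y
    · rw [if_neg (c := (p q l y).rev = p q l x), mul_zero]
      intro h2
      exact hkl (p_sep q k l x y h1 (by rw [← h2, Fin.rev_rev]))
    · rw [if_neg h1, zero_mul]

theorem psd_add {V : Type*} [Fintype V] [DecidableEq V] (M : Matrix V V ℂ) (h1 : Mᴴ = M)
    (h2 : M * M = 1) : (1 + M).PosSemidef := by
  have h := (posSemidef_conjTranspose_mul_self (1 + M)).smul (a := (1 / 2 : ℂ)) (by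
    rw [Complex.le_def]; norm_num)
  convert h using 1
  rw [conjTranspose_add, h1, conjTranspose_one, add_mul, mul_add, mul_add, h2]
  simp only [mul_one, one_mul]
  ext i j
  simp
  ring

theorem psd_sub {V : Type*} [Fintype V] [DecidableEq V] (M : Matrix V V ℂ) (h1 : Mᴴ = M)
    (h2 : M * M = 1) : (1 - M).PosSemidef := by
  rw [sub_eq_add_neg]
  exact psd_add (-M) (by simp [h1]) (by simp [h2])

theorem trace_diag_mul {V : Type*} [Fintype V] [DecidableEq V] (d : V → ℂ) (M : Matrix V V ℂ)
    (hM : ∀ x, M x x = 0) : (diagonal d * M).trace = 0 := by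
  simp [trace, diagonal_mul, hM]

/-- diagonal entries -/
noncomputable def f (q : ℕ) (c : ZMod (2 * q + 1)) : Option (ZMod (2 * q + 1)) → ℂ
  | none => 2
  | some x => if x = c then 0 else 1

/-- left factor -/
noncomputable def EE (q : ℕ) (z : ℂ) :
    (ZMod (2 * q + 1) × Fin (2 * q + 1 + 1)) ⊕ ZMod (2 * q + 1) →
    Matrix (Option (ZMod (2 * q + 1))) (Option (ZMod (2 * q + 1))) ℂ
  | .inl s => (1 / (2 * q + 1 + 1 : ℂ)) • (1 + H q z s)
  | .inr c => diagonal (Pi.single (some c) 1)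

/-- right factor -/
noncomputable def FF (q : ℕ) (z : ℂ) :
    (ZMod (2 * q + 1) × Fin (2 * q + 1 + 1)) ⊕ ZMod (2 * q + 1) →
    Matrix (Option (ZMod (2 * q + 1))) (Option (ZMod (2 * q + 1))) ℂ
  | .inl s => 1 - H q z s
  | .inr c => diagonal (f q c)

theorem f_sum (q : ℕ) (c) : ∑ x, f q c x = 2 * q + 1 + 1 := by
  rw [Fintype.sum_option]
  simp only [f]
  have : ∀ x : ZMod (2 * q + 1), (if x = c then (0 : ℂ) else 1) = 1 - if x = c then 1 else 0 := by
    intro x; split_ifs <;> simp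
  simp only [this, Finset.sum_sub_distrib, Finset.sum_ite_eq', Finset.mem_univ, if_true]
  simp [ZMod.card]
  ring

theorem main (q : ℕ) (z : ℂ) (hp : IsPrimitiveRoot z (2 * (2 * q + 1 + 1))) :
    (∀ i, (EE q z i).PosSemidef) ∧ (∀ i, (FF q z i).PosSemidef) ∧
    ∀ i j, (EE q z i * FF q z j).trace = if i = j then 0 else 1 := by
  have hz : z ≠ 0 := hp.ne_zero (by omega)
  have hz' : star z = z⁻¹ := (Complex.inv_eq_conj (hp.norm'_eq_one (by omega))).symm
  have hq : (2 * q + 1 + 1 : ℂ) ≠ 0 := by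
    exact_mod_cast (by omega : 2 * q + 1 + 1 ≠ 0)
  have hcard : (1 : Matrix (Option (ZMod (2 * q + 1))) (Option (ZMod (2 * q + 1))) ℂ).trace
      = 2 * q + 1 + 1 := by
    rw [trace_one]; simp [ZMod.card]
  refine ⟨?_, ?_, ?_⟩
  · rintro (s | c)
    · refine (psd_add _ (H_herm hz' s) (H_sq hz s)).smul ?_
      have : (0 : ℂ) ≤ ((1 / (2 * q + 1 + 1) : ℝ) : ℂ) := by
        rw [Complex.zero_le_real]; positivity
      simpa using this
    · refine PosSemidef.diagonal ?_
      intro x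
      by_cases h : x = some c
      · subst h; simp
      · simp [h]
  · rintro (s | c)
    · exact psd_sub _ (H_herm hz' s) (H_sq hz s)
    · refine PosSemidef.diagonal ?_
      rintro (_ | x)
      · simp [f]
      · simp only [f, Pi.zero_apply]; split_ifs <;> simp
  · rintro (s | c) (t | d)
    · simp only [EE, FF, smul_mul, trace_smul, add_mul, mul_sub, one_mul, mul_one, trace_add,
        trace_sub, H_tr, hcard, Sum.inl.injEq]
      split_ifs with h
      · subst h; rw [H_sq hz, hcard]; simp
      · rw [H_orth hp s t h]; simp [hq]
    · simp only [EE, FF, smul_mul, trace_smul, add_mul, one_mul, trace_add]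
      rw [trace_mul_comm (H q z s), trace_diag_mul _ _ (H_diag q z s), trace_diagonal, f_sum]
      simp [hq]
    · simp only [EE, FF, mul_sub, mul_one, trace_sub]
      rw [trace_diag_mul _ _ (H_diag q z t), trace_diagonal]
      simp
    · simp only [EE, FF, diagonal_mul_diagonal, trace_diagonal, Sum.inr.injEq]
      rw [Finset.sum_eq_single (some c)]
      · simp [f]
      · intro x _ hx; simp [hx]
      · simp

end PrankAux

/-- For even `n`, the nonequality matrix of size `n² - 1` has PSD-rank at most `n`. -/
theorem prank_nonequality_even {n : ℕ} (hn : Even n) (hpos : 0 < n)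
    (A : Matrix (Fin (n ^ 2 - 1)) (Fin (n ^ 2 - 1)) ℝ)
    (hA : ∀ i j, A i j = if i = j then 0 else 1) :
    prank A ≤ n := by
  obtain ⟨q, rfl⟩ : ∃ q, n = 2 * q + 1 + 1 := by
    obtain ⟨r, hr⟩ := hn
    exact ⟨r - 1, by omega⟩
  obtain ⟨h1, h2, h3⟩ := PrankAux.main q _
    (Complex.isPrimitiveRoot_exp (2 * (2 * q + 1 + 1)) (by omega))
  set z := Complex.exp (2 * Real.pi * Complex.I / (2 * (2 * q + 1 + 1) : ℕ))
  have e : Fin ((2 * q + 1 + 1) ^ 2 - 1) ≃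
      (ZMod (2 * q + 1) × Fin (2 * q + 1 + 1)) ⊕ ZMod (2 * q + 1) := by
    apply Fintype.equivOfCardEq
    simp only [Fintype.card_sum, Fintype.card_prod, ZMod.card, Fintype.card_fin]
    apply Nat.sub_eq_of_eq_add
    ring
  let g : Fin (2 * q + 1 + 1) ≃ Option (ZMod (2 * q + 1)) := (PrankAux.p q 0).symm
  refine Nat.sInf_le ⟨fun i => (PrankAux.EE q z (e i)).submatrix g g,
    fun i => (PrankAux.FF q z (e i)).submatrix g g, fun i => (h1 _).submatrix _,
    fun i => (h2 _).submatrix _, fun i j => ?_⟩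
  rw [Matrix.submatrix_mul_equiv, hA]
  have h4 := h3 (e i) (e j)
  have h5 : ((PrankAux.EE q z (e i) * PrankAux.FF q z (e j)).submatrix g g).trace =
      (PrankAux.EE q z (e i) * PrankAux.FF q z (e j)).trace := by
    simp only [Matrix.trace, Matrix.diag_apply, Matrix.submatrix_apply]
    exact Equiv.sum_comp g (fun x => (PrankAux.EE q z (e i) * PrankAux.FF q z (e j)) x x)
  rw [h5, h4]
  simp only [e.injective.eq_iff]
  split_ifs <;> simp
end

section
/- Let ε ≥ 0 and let A be an n×n real matrix with A(i,i) = 1 for all i and 0 ≤ A(i,j) ≤ ε for all i ≠ j. Then prank(A) ≥ n / (1 + ε(n−1)). In particular, if ε ≤ 1/n then prank(A) > n/2. -/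
open scoped ComplexOrder

section aux
open Matrix

open scoped MatrixOrder Matrix.Norms.L2Operator in
theorem psd_fact {r : ℕ} {X : Matrix (Fin r) (Fin r) ℂ} (h : X.PosSemidef) :
    ∃ B : Matrix (Fin r) (Fin r) ℂ, X = Bᴴ * B := by
  obtain ⟨B, hB⟩ := CStarAlgebra.nonneg_iff_eq_star_mul_self.mp h.nonneg
  exact ⟨B, hB⟩

open scoped Matrix.Norms.Frobenius in
theorem tr_submul {r : ℕ} (M N : Matrix (Fin r) (Fin r) ℂ) :
    ((M * N)ᴴ * (M * N)).trace.re ≤ (Mᴴ * M).trace.re * (Nᴴ * N).trace.re := by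
  have key : ∀ X : Matrix (Fin r) (Fin r) ℂ, (Xᴴ * X).trace.re = ‖X‖ ^ 2 := by
    intro X
    rw [Matrix.frobenius_norm_def, ← Real.sqrt_eq_rpow, Real.sq_sqrt (by positivity)]
    simp only [Matrix.trace, Matrix.diag, Matrix.mul_apply, Matrix.conjTranspose_apply,
      Complex.re_sum, Real.rpow_two]
    rw [Finset.sum_comm]
    refine Finset.sum_congr rfl fun i _ => Finset.sum_congr rfl fun j _ => ?_
    rw [← Complex.normSq_eq_norm_sq, Complex.normSq_apply]
    simp
  rw [key, key, key, ← mul_pow]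
  exact pow_le_pow_left₀ (norm_nonneg _) (Matrix.frobenius_norm_mul M N) 2

theorem tr_key {r : ℕ} {E F S : Matrix (Fin r) (Fin r) ℂ} (hE : E.PosSemidef)
    (hF : F.PosSemidef) (hS : S.PosDef) :
    (E * F).trace.re ≤ (E * S⁻¹).trace.re * (S * F).trace.re := by
  obtain ⟨M, rfl⟩ := psd_fact hE
  obtain ⟨N, hN⟩ := psd_fact hF
  obtain ⟨B, hB⟩ := psd_fact hS.posSemidef
  have hu := (Matrix.isUnit_iff_isUnit_det _).1 hS.isUnit
  have hBu : IsUnit B.det := by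
    rw [hB, Matrix.det_mul] at hu
    exact isUnit_of_mul_isUnit_right hu
  have h := tr_submul (M * B⁻¹) (B * Nᴴ)
  have e0 : (M * B⁻¹) * (B * Nᴴ) = M * Nᴴ := by
    rw [Matrix.mul_assoc, ← Matrix.mul_assoc B⁻¹, Matrix.nonsing_inv_mul _ hBu, Matrix.one_mul]
  have e1 : ((M * Nᴴ)ᴴ * (M * Nᴴ)).trace = (Mᴴ * M * F).trace := by
    rw [hN, Matrix.conjTranspose_mul, Matrix.conjTranspose_conjTranspose,
      Matrix.mul_assoc, Matrix.trace_mul_comm]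
    simp only [Matrix.mul_assoc]
  have e2 : ((M * B⁻¹)ᴴ * (M * B⁻¹)).trace = (Mᴴ * M * S⁻¹).trace := by
    rw [hB, Matrix.mul_inv_rev, Matrix.conjTranspose_mul,
      Matrix.mul_assoc, Matrix.trace_mul_comm, Matrix.conjTranspose_nonsing_inv]
    simp only [Matrix.mul_assoc]
  have e3 : ((B * Nᴴ)ᴴ * (B * Nᴴ)).trace = (S * F).trace := by
    rw [hN, hB, Matrix.conjTranspose_mul, Matrix.conjTranspose_conjTranspose,
      Matrix.mul_assoc, Matrix.trace_mul_comm]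
    simp only [Matrix.mul_assoc]
  rwa [e0, e1, e2, e3] at h

theorem fact_bound {n r : ℕ} (hn : 0 < n) (C : ℝ) (A : Matrix (Fin n) (Fin n) ℝ)
    (hdiag : ∀ i, A i i = 1) (hC : ∀ j, ∑ i, A i j ≤ C)
    (E F : Fin n → Matrix (Fin r) (Fin r) ℂ)
    (hE : ∀ i, (E i).PosSemidef) (hF : ∀ i, (F i).PosSemidef)
    (hA : ∀ i j, (A i j : ℂ) = ((E i) * (F j)).trace) : (n : ℝ) ≤ r * C := by
  have hFt : ∀ j, 0 ≤ (F j).trace.re := fun j => (Complex.nonneg_iff.1 (hF j).trace_nonneg).1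
  set T := ∑ j, (F j).trace.re with hT
  have hT0 : 0 ≤ T := Finset.sum_nonneg fun j _ => hFt j
  have main : ∀ δ : ℝ, 0 < δ → (n : ℝ) ≤ r * (C + δ * T) := by
    intro δ hδ
    set S₀ := ∑ i, E i with hS₀
    set S := S₀ + (δ : ℂ) • (1 : Matrix (Fin r) (Fin r) ℂ) with hSdef
    have hS : S.PosDef := by
      refine Matrix.PosDef.posSemidef_add (Matrix.posSemidef_sum _ fun i _ => hE i) ?_
      exact Matrix.PosDef.one.smul (by exact_mod_cast hδ)
    have hu := (Matrix.isUnit_iff_isUnit_det _).1 hS.isUnit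
    have hx0 : ∀ i, (S * F i).trace.re ≤ C + δ * T := by
      intro i
      have : (S * F i).trace = ((∑ k, A k i : ℝ) : ℂ) + δ * (F i).trace := by
        rw [hSdef, hS₀, Matrix.add_mul, Matrix.sum_mul, Matrix.trace_add, Matrix.trace_sum]
        simp [hA]
      rw [this, Complex.add_re, Complex.ofReal_re, Complex.re_ofReal_mul]
      have h1 : (F i).trace.re ≤ T :=
        Finset.single_le_sum (f := fun j => (F j).trace.re) (fun j _ => hFt j) (Finset.mem_univ i)
      have := hC i
      nlinarith
    have hEs : ∀ i, 0 ≤ (E i * S⁻¹).trace.re := by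
      intro i
      obtain ⟨M, hM⟩ := psd_fact (hE i)
      have := (hS.inv.posSemidef.mul_mul_conjTranspose_same M).trace_nonneg
      rw [Matrix.mul_assoc, Matrix.trace_mul_comm, Matrix.mul_assoc, Matrix.trace_mul_comm] at this
      exact (Complex.nonneg_iff.1 this).1.trans_eq (by rw [hM])
    have hsum : ∑ i, (E i * S⁻¹).trace.re ≤ r := by
      have h1 : ∑ i, (E i * S⁻¹).trace = (r : ℂ) - δ * (S⁻¹).trace := by
        rw [← Matrix.trace_sum, ← Matrix.sum_mul, ← hS₀]
        have : S₀ = S - (δ : ℂ) • (1 : Matrix (Fin r) (Fin r) ℂ) := by rw [hSdef]; simp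
        rw [this, Matrix.sub_mul, Matrix.mul_nonsing_inv _ hu]
        simp
      rw [← Complex.re_sum, h1, Complex.sub_re, Complex.re_ofReal_mul, Complex.natCast_re]
      have := (Complex.nonneg_iff.1 hS.inv.posSemidef.trace_nonneg).1
      nlinarith
    have h1 : ∀ i, 1 ≤ (E i * S⁻¹).trace.re * (C + δ * T) := by
      intro i
      have h := tr_key (hE i) (hF i) hS
      rw [← hA, hdiag] at h
      simp only [Complex.ofReal_one, Complex.one_re] at h
      exact h.trans (mul_le_mul_of_nonneg_left (hx0 i) (hEs i))
    have hp : 0 ≤ C + δ * T := by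
      by_contra hneg
      have := h1 ⟨0, hn⟩
      have := hEs ⟨0, hn⟩
      nlinarith
    calc (n : ℝ) = ∑ i : Fin n, (1 : ℝ) := by simp
      _ ≤ ∑ i, (E i * S⁻¹).trace.re * (C + δ * T) := Finset.sum_le_sum fun i _ => h1 i
      _ = (∑ i, (E i * S⁻¹).trace.re) * (C + δ * T) := by rw [Finset.sum_mul]
      _ ≤ _ := mul_le_mul_of_nonneg_right hsum hp
  refine le_of_forall_pos_le_add fun η hη => ?_
  have hd : 0 < (r : ℝ) * T + 1 := by positivity
  have := main (η / (r * T + 1)) (by positivity)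
  have h2 : η / (r * T + 1) * (r * T) ≤ η := by
    rw [div_mul_eq_mul_div, div_le_iff₀ hd]; nlinarith
  nlinarith

end aux

/-- An `ε`-approximation of the `n × n` identity has PSD-rank at least
`n / (1 + ε(n-1))`; in particular if `ε ≤ 1/n` then `prank A > n/2`. -/
theorem prank_approx_identity_lower_bound {n : ℕ} (hn : 0 < n)
    (ε : ℝ) (hε : 0 ≤ ε) (A : Matrix (Fin n) (Fin n) ℝ)
    (hdiag : ∀ i, A i i = 1)
    (hoff : ∀ i j, i ≠ j → 0 ≤ A i j ∧ A i j ≤ ε) :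
    (n : ℝ) / (1 + ε * ((n : ℝ) - 1)) ≤ (prank A : ℝ) ∧
    (ε ≤ 1 / (n : ℝ) → (n : ℝ) / 2 < (prank A : ℝ)) := by
  have hn1 : (1 : ℝ) ≤ n := by exact_mod_cast hn
  have hA0 : ∀ i j, 0 ≤ A i j := by
    intro i j
    by_cases h : i = j
    · subst h; rw [hdiag]; exact zero_le_one
    · exact (hoff i j h).1
  have hpos : 0 < 1 + ε * ((n : ℝ) - 1) := by nlinarith
  have hC : ∀ j, ∑ i, A i j ≤ 1 + ε * ((n : ℝ) - 1) := by
    intro j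
    rw [← Finset.add_sum_erase _ _ (Finset.mem_univ j), hdiag]
    have h := Finset.sum_le_card_nsmul (Finset.univ.erase j) (fun i => A i j) ε
      (fun i hi => (hoff i j (Finset.ne_of_mem_erase hi)).2)
    rw [Finset.card_erase_of_mem (Finset.mem_univ j), Finset.card_univ, Fintype.card_fin,
      nsmul_eq_mul, Nat.cast_sub hn, Nat.cast_one] at h
    linarith
  have hne : {r : ℕ |
    ∃ (E : Fin n → Matrix (Fin r) (Fin r) ℂ) (F : Fin n → Matrix (Fin r) (Fin r) ℂ),
      (∀ i, (E i).PosSemidef) ∧ (∀ j, (F j).PosSemidef) ∧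
      ∀ i j, (A i j : ℂ) = ((E i) * (F j)).trace}.Nonempty := by
    refine ⟨n, fun i => Matrix.diagonal (Pi.single i 1),
      fun j => Matrix.diagonal (fun k => (A k j : ℂ)), ?_, ?_, ?_⟩
    · intro i
      refine Matrix.PosSemidef.diagonal ?_
      exact Pi.single_nonneg.2 zero_le_one
    · intro j
      refine Matrix.PosSemidef.diagonal fun k => ?_
      exact Complex.zero_le_real.2 (hA0 k j)
    · intro i j
      rw [Matrix.diagonal_mul_diagonal, Matrix.trace_diagonal]
      simp [Pi.single_apply]
  obtain ⟨E, F, hE, hF, hEF⟩ := Nat.sInf_mem hne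
  have hb : (n : ℝ) ≤ (prank A : ℝ) * (1 + ε * ((n : ℝ) - 1)) :=
    fact_bound hn _ A hdiag hC E F hE hF hEF
  have h1 : (n : ℝ) / (1 + ε * ((n : ℝ) - 1)) ≤ (prank A : ℝ) := by
    rwa [div_le_iff₀ hpos]
  refine ⟨h1, fun h => lt_of_lt_of_le ?_ h1⟩
  have hn0 : (0 : ℝ) < n := by linarith
  rw [le_div_iff₀ hn0] at h
  exact div_lt_div_of_pos_left hn0 hpos (by nlinarith)
end

section
/- Let n ≥ 3, let ε ≥ 0, and let A be the n×n matrix with A(i,i) = 1 for all i and A(i,j) = ε for all i ≠ j. Then prank(A) = n if and only if ε < 1/(n−1)². -/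
open scoped ComplexOrder

open Matrix Finset in
theorem aux_trace_rank {N : Type*} [Fintype N] [DecidableEq N] (M : Matrix N N ℂ) :
    ‖M.trace‖ ^ 2 ≤ (M.rank : ℝ) * ∑ i, ∑ j, ‖M i j‖ ^ 2 := by
  have hH : (M * Mᴴ).IsHermitian := isHermitian_mul_conjTranspose_self M
  set U : Matrix N N ℂ := (hH.eigenvectorUnitary : Matrix N N ℂ) with hU
  have hUU : Uᴴ * U = 1 := by
    have := (Matrix.mem_unitaryGroup_iff' (A := U)).1 hH.eigenvectorUnitary.2
    simpa [star_eq_conjTranspose] using this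
  have hUU' : U * Uᴴ = 1 := mul_eq_one_comm.1 hUU
  set K := Uᴴ * M * U with hK
  have hKK : K * Kᴴ = diagonal (fun i => (hH.eigenvalues i : ℂ)) := by
    have h1 := hH.spectral_theorem
    rw [Unitary.conjStarAlgAut_apply] at h1
    have h2 : K * Kᴴ = Uᴴ * (M * Mᴴ) * U := by
      simp only [hK, conjTranspose_mul, conjTranspose_conjTranspose, Matrix.mul_assoc]
      rw [← Matrix.mul_assoc U Uᴴ, hUU', Matrix.one_mul]
    refine (h2.trans (congrArg (fun Z => Uᴴ * Z * U) h1)).trans ?_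
    change Uᴴ * (U * diagonal (RCLike.ofReal ∘ hH.eigenvalues) * Uᴴ) * U = _
    rw [Matrix.mul_assoc U, ← Matrix.mul_assoc Uᴴ, hUU, Matrix.one_mul, Matrix.mul_assoc, hUU,
      Matrix.mul_one]
    rfl
  have hsq : ∀ (L : Matrix N N ℂ) i, (L * Lᴴ) i i = ((∑ j, ‖L i j‖ ^ 2 : ℝ) : ℂ) := by
    intro L i
    rw [Matrix.mul_apply]
    push_cast
    refine Finset.sum_congr rfl fun j _ => ?_
    rw [conjTranspose_apply]
    exact RCLike.mul_conj (L i j)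
  have hrow : ∀ i, ∑ j, ‖K i j‖ ^ 2 = hH.eigenvalues i := by
    intro i
    have := hsq K i
    rw [hKK, diagonal_apply_eq] at this
    exact_mod_cast this.symm
  have htr : M.trace = K.trace := by
    rw [hK, Matrix.trace_mul_comm, ← Matrix.mul_assoc, hUU', Matrix.one_mul]
  have hsum : ∑ i, ∑ j, ‖M i j‖ ^ 2 = ∑ i, hH.eigenvalues i := by
    have h1 : (M * Mᴴ).trace = (K * Kᴴ).trace := by
      have h2 : K * Kᴴ = Uᴴ * (M * Mᴴ) * U := by
        simp only [hK, conjTranspose_mul, conjTranspose_conjTranspose, Matrix.mul_assoc]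
        rw [← Matrix.mul_assoc U Uᴴ, hUU', Matrix.one_mul]
      rw [h2, Matrix.trace_mul_comm (Uᴴ * (M * Mᴴ)), ← Matrix.mul_assoc, hUU', Matrix.one_mul]
    rw [hKK, Matrix.trace, Matrix.trace] at h1
    simp only [diag_apply, hsq, diagonal_apply_eq] at h1
    exact_mod_cast h1
  have hrank : M.rank = (univ.filter fun i => hH.eigenvalues i ≠ 0).card := by
    rw [← Matrix.rank_self_mul_conjTranspose, hH.rank_eq_card_non_zero_eigs, Fintype.card_subtype]
  have hle : ∀ i, ‖K i i‖ ^ 2 ≤ hH.eigenvalues i := by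
    intro i
    rw [← hrow i]
    exact Finset.single_le_sum (f := fun j => ‖K i j‖ ^ 2) (fun j _ => by positivity) (mem_univ i)
  rw [hrank, hsum, htr]
  set S := univ.filter fun i => hH.eigenvalues i ≠ 0 with hS
  have h0 : K.trace = ∑ i ∈ S, K i i := by
    rw [Matrix.trace, hS, Finset.sum_filter]
    refine Finset.sum_congr rfl fun i _ => ?_
    split_ifs with h
    · rfl
    · push Not at h
      have := hle i
      rw [h] at this
      have h3 : ‖K i i‖ = 0 := by
        have := norm_nonneg (K i i)
        nlinarith
      simpa using h3
  rw [h0]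
  calc ‖∑ i ∈ S, K i i‖ ^ 2 ≤ (∑ i ∈ S, ‖K i i‖) ^ 2 := by
        gcongr; exact norm_sum_le _ _
    _ ≤ (S.card : ℝ) * ∑ i ∈ S, ‖K i i‖ ^ 2 := sq_sum_le_card_mul_sum_sq
    _ ≤ (S.card : ℝ) * ∑ i, hH.eigenvalues i := by
        gcongr
        calc ∑ i ∈ S, ‖K i i‖ ^ 2 ≤ ∑ i, ‖K i i‖ ^ 2 :=
              Finset.sum_le_sum_of_subset_of_nonneg (subset_univ _) (fun _ _ _ => by positivity)
          _ ≤ _ := Finset.sum_le_sum fun i _ => hle i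

open Matrix Finset in
theorem aux_frob {r : ℕ} (B C : Matrix (Fin r) (Fin r) ℂ) :
    ∑ i, ∑ j, ‖(B * C) i j‖ ^ 2 ≤ (∑ i, ∑ j, ‖B i j‖ ^ 2) * ∑ i, ∑ j, ‖C i j‖ ^ 2 := by
  have h : ∀ i j, ‖(B * C) i j‖ ^ 2 ≤ (∑ k, ‖B i k‖ ^ 2) * ∑ k, ‖C k j‖ ^ 2 := by
    intro i j
    rw [Matrix.mul_apply]
    calc ‖∑ k, B i k * C k j‖ ^ 2 ≤ (∑ k, ‖B i k‖ * ‖C k j‖) ^ 2 := by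
          gcongr
          refine (norm_sum_le _ _).trans (le_of_eq ?_)
          simp
      _ ≤ _ := Finset.sum_mul_sq_le_sq_mul_sq _ _ _
  calc _ ≤ ∑ i, ∑ j, (∑ k, ‖B i k‖ ^ 2) * ∑ k, ‖C k j‖ ^ 2 :=
        Finset.sum_le_sum fun i _ => Finset.sum_le_sum fun j _ => h i j
    _ = _ := by
        rw [← Finset.sum_mul_sum, Finset.sum_comm (f := fun i j => ‖C i j‖ ^ 2)]

open Matrix Finset in
theorem aux_frob_trace {r : ℕ} (B : Matrix (Fin r) (Fin r) ℂ) :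
    (Bᴴ * B).trace = ((∑ i, ∑ j, ‖B i j‖ ^ 2 : ℝ) : ℂ) := by
  rw [Matrix.trace_mul_comm, Matrix.trace]
  push_cast
  refine Finset.sum_congr rfl fun i _ => ?_
  rw [diag_apply, Matrix.mul_apply]
  refine Finset.sum_congr rfl fun j _ => ?_
  rw [conjTranspose_apply]
  exact RCLike.mul_conj (B i j)

open Matrix Finset MatrixOrder Matrix.Norms.L2Operator in
theorem aux_lower_s15 {n r : ℕ} (A : Matrix (Fin n) (Fin n) ℝ)
    (hd : ∀ i, A i i = 1)
    (E F : Fin n → Matrix (Fin r) (Fin r) ℂ)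
    (hE : ∀ i, (E i).PosSemidef) (hF : ∀ j, (F j).PosSemidef)
    (h : ∀ i j, (A i j : ℂ) = ((E i) * (F j)).trace) :
    (n : ℝ) ^ 2 ≤ (r : ℝ) * ∑ i, ∑ j, A i j := by
  have hX : ∀ i, ∃ X : Matrix (Fin r) (Fin r) ℂ, E i = X * Xᴴ := by
    intro i
    obtain ⟨B, hB⟩ := CStarAlgebra.nonneg_iff_eq_star_mul_self.mp (hE i).nonneg
    exact ⟨Bᴴ, by simpa [star_eq_conjTranspose] using hB⟩
  have hY : ∀ i, ∃ X : Matrix (Fin r) (Fin r) ℂ, F i = X * Xᴴ := by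
    intro i
    obtain ⟨B, hB⟩ := CStarAlgebra.nonneg_iff_eq_star_mul_self.mp (hF i).nonneg
    exact ⟨Bᴴ, by simpa [star_eq_conjTranspose] using hB⟩
  choose X hX using hX
  choose Y hY using hY
  have hK : ∀ i j, ∑ a, ∑ b, ‖((X i)ᴴ * Y j) a b‖ ^ 2 = A i j := by
    intro i j
    have h1 := aux_frob_trace ((X i)ᴴ * Y j)
    have h2 : (((X i)ᴴ * Y j)ᴴ * ((X i)ᴴ * Y j)).trace = (A i j : ℂ) := by
      rw [h, hX, hY, conjTranspose_mul, conjTranspose_conjTranspose, Matrix.mul_assoc,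
        Matrix.trace_mul_comm]
      simp only [Matrix.mul_assoc]
    rw [h2] at h1
    exact_mod_cast h1.symm
  have hK' : ∀ i j, ∑ a, ∑ b, ‖((X i)ᴴ * Y j)ᴴ a b‖ ^ 2 = A i j := by
    intro i j
    rw [← hK, Finset.sum_comm]
    simp [conjTranspose_apply]
  let U : Matrix (Fin n × Fin r) (Fin r) ℂ := fun p c => ((Y p.1)ᴴ * E p.1) p.2 c
  let V : Matrix (Fin r) (Fin n × Fin r) ℂ := fun c p => Y p.1 c p.2
  have hM : ∀ p q, (U * V) p q =
      (((X p.1)ᴴ * Y p.1)ᴴ * ((X p.1)ᴴ * Y q.1)) p.2 q.2 := by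
    intro p q
    have : (((X p.1)ᴴ * Y p.1)ᴴ * ((X p.1)ᴴ * Y q.1)) = ((Y p.1)ᴴ * E p.1) * Y q.1 := by
      rw [hX]; simp [Matrix.mul_assoc]
    rw [this, Matrix.mul_apply, Matrix.mul_apply]
  have hr : (U * V).rank ≤ r := by
    refine (Matrix.rank_mul_le_left U V).trans ?_
    simpa using Matrix.rank_le_card_width U
  have htr : (U * V).trace = n := by
    rw [Matrix.trace, Fintype.sum_prod_type]
    have : ∀ i, ∑ a, (U * V).diag (i, a) = 1 := by
      intro i
      have h1 := aux_frob_trace ((X i)ᴴ * Y i)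
      rw [hK, hd] at h1
      rw [Matrix.trace] at h1
      simp only [diag_apply] at h1 ⊢
      simp only [hM]
      simpa using h1
    simp only [this]
    simp
  have hs : ∑ p, ∑ q, ‖(U * V) p q‖ ^ 2 ≤ ∑ i, ∑ j, A i j := by
    rw [Fintype.sum_prod_type]
    refine Finset.sum_le_sum fun i _ => ?_
    rw [Finset.sum_congr rfl (fun a _ => Fintype.sum_prod_type _), Finset.sum_comm]
    refine Finset.sum_le_sum fun j _ => ?_
    simp only [hM]
    refine (aux_frob _ _).trans ?_
    rw [hK, hK', hd, one_mul]
  have := aux_trace_rank (U * V)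
  rw [htr] at this
  simp only [Complex.norm_natCast] at this
  refine this.trans ?_
  have h3 : (0:ℝ) ≤ ∑ p, ∑ q, ‖(U * V) p q‖ ^ 2 := by positivity
  have h4 : ((U * V).rank : ℝ) ≤ r := by exact_mod_cast hr
  gcongr

open Matrix Finset in
theorem aux_vecs (m : ℕ) (hm : 1 ≤ m) : ∃ u : Fin (m + 1) → Fin m → ℝ,
    ∀ i j, u i ⬝ᵥ u j = if i = j then 1 else -1 / (m : ℝ) := by
  -- Gram matrix (1 + 1/m) (δ - 1/(m+1))
  have hm0 : (m : ℝ) ≠ 0 := by positivity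
  have hm1 : (m : ℝ) + 1 ≠ 0 := by positivity
  obtain ⟨s, hs⟩ : ∃ s : ℝ, s ^ 2 * (m + 1) = 1 :=
    ⟨1 / √(m + 1), by rw [div_pow, Real.sq_sqrt (by positivity)]; field_simp⟩
  obtain ⟨t, ht⟩ : ∃ t : ℝ, t ^ 2 * m = m + 1 :=
    ⟨√((m + 1) / m), by rw [Real.sq_sqrt (by positivity)]; field_simp⟩
  have hs' : s ^ 2 = 1 / (m + 1) := by field_simp; exact hs
  have ht' : t ^ 2 = (m + 1) / m := by field_simp; exact ht
  set c : ℝ := -(1 + s) / m with hc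
  refine ⟨Fin.lastCases (fun _ => t * s) (fun i k => t * ((if i = k then 1 else 0) + c)), ?_⟩
  intro i j
  induction i using Fin.lastCases with
  | last =>
    induction j using Fin.lastCases with
    | last =>
      simp [dotProduct]
      have : (m : ℝ) * (t * s * (t * s)) = m * (t ^ 2) * s ^ 2 := by ring
      rw [this, hs', ht']; field_simp
    | cast j =>
      have hne : Fin.last m ≠ j.castSucc := (Fin.castSucc_lt_last j).ne'
      simp only [dotProduct, Fin.lastCases_last, Fin.lastCases_castSucc, hne, if_false]
      rw [← Finset.mul_sum, ← Finset.mul_sum, Finset.sum_add_distrib]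
      simp
      have : t * s * (t * (1 + (m : ℝ) * c)) = t ^ 2 * (s + s * (m * c)) := by ring
      rw [this, hc, mul_div_cancel₀ _ hm0, ht']
      have : s + s * -(1 + s) = - s ^ 2 := by ring
      rw [this, hs']; field_simp
  | cast i =>
    induction j using Fin.lastCases with
    | last =>
      have hne : i.castSucc ≠ Fin.last m := (Fin.castSucc_lt_last i).ne
      simp only [dotProduct, Fin.lastCases_last, Fin.lastCases_castSucc, hne, if_false]
      rw [← Finset.sum_mul, ← Finset.mul_sum, Finset.sum_add_distrib]
      simp
      have : t * (1 + (m : ℝ) * c) * (t * s) = t ^ 2 * (s + s * (m * c)) := by ring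
      rw [this, hc, mul_div_cancel₀ _ hm0, ht']
      have : s + s * -(1 + s) = - s ^ 2 := by ring
      rw [this, hs']; field_simp
    | cast j =>
      simp only [dotProduct, Fin.lastCases_castSucc, Fin.castSucc_inj]
      have : ∀ k, t * ((if i = k then (1:ℝ) else 0) + c) * (t * ((if j = k then 1 else 0) + c))
          = t ^ 2 * ((if i = k then (if j = k then (1:ℝ) else 0) else 0)
            + (if i = k then c else 0) + (if j = k then c else 0) + c ^ 2) := by
        intro k; split_ifs <;> ring
      simp only [this]
      rw [← Finset.mul_sum, Finset.sum_add_distrib, Finset.sum_add_distrib,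
        Finset.sum_add_distrib]
      simp only [Finset.sum_ite_eq, Finset.mem_univ, if_true, Finset.sum_const, Finset.card_univ,
        Fintype.card_fin, nsmul_eq_mul]
      have h5 : c + c + m * c ^ 2 = -1 / (m + 1) := by
        have : c + c + m * c ^ 2 = c * (2 + m * c) := by ring
        rw [this, hc, mul_div_cancel₀ _ hm0]
        have : -(1 + s) / (m:ℝ) * (2 + -(1 + s)) = -(1 - s ^ 2) / m := by ring
        rw [this, hs']; field_simp; ring
      rw [add_assoc, add_assoc, ← add_assoc c c, h5, ht']
      by_cases hij : i = j
      · simp [hij]; field_simp; ring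
      · simp [hij, Ne.symm hij]; field_simp

open Matrix Finset in
theorem aux_upper {m : ℕ} (hm : 2 ≤ m) (ε : ℝ) (hε : 1 / (m : ℝ) ^ 2 ≤ ε)
    (A : Matrix (Fin (m + 1)) (Fin (m + 1)) ℝ)
    (hA : ∀ i j, A i j = if i = j then 1 else ε) :
    ∃ (E : Fin (m + 1) → Matrix (Fin m) (Fin m) ℂ) (F : Fin (m + 1) → Matrix (Fin m) (Fin m) ℂ),
      (∀ i, (E i).PosSemidef) ∧ (∀ j, (F j).PosSemidef) ∧
      ∀ i j, (A i j : ℂ) = ((E i) * (F j)).trace := by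
  obtain ⟨u, hu⟩ := aux_vecs m (by omega)
  have hm2 : (2 : ℝ) ≤ m := by exact_mod_cast hm
  let w : Fin (m + 1) → Fin m → ℂ := fun i k => (u i k : ℂ)
  have hstar : ∀ i, star (w i) = w i := by
    intro i; ext k; simp [w]
  have hw : ∀ i j, w i ⬝ᵥ w j = ((u i ⬝ᵥ u j : ℝ) : ℂ) := by
    intro i j; simp [w, dotProduct]
  let R : Fin (m + 1) → Matrix (Fin m) (Fin m) ℂ := fun i => vecMulVec (w i) (w i)
  have hR : ∀ i, (R i).PosSemidef := by
    intro i
    have := Matrix.posSemidef_vecMulVec_self_star (w i)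
    rwa [hstar] at this
  have hRR : ∀ i, R i * R i = R i := by
    intro i
    simp [R, vecMulVec_mul_vecMulVec, hw, hu]
  have hQ : ∀ i, (1 - R i).PosSemidef := by
    intro i
    have h1 : (1 - R i)ᴴ * (1 - R i) = 1 - R i := by
      rw [conjTranspose_sub, conjTranspose_one, (hR i).1.eq, sub_mul, mul_sub, mul_sub, hRR]
      simp
    rw [← h1]
    exact posSemidef_conjTranspose_mul_self _
  have htR : ∀ i, (R i).trace = 1 := by
    intro i
    simp [R, trace_vecMulVec, hw, hu]
  have htRR : ∀ i j, (R i * R j).trace = (((u i ⬝ᵥ u j) ^ 2 : ℝ) : ℂ) := by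
    intro i j
    simp only [R, vecMulVec_mul_vecMulVec, trace_smul, trace_vecMulVec, dotProduct_smul,
      smul_dotProduct, vecMulVec_smul, smul_vecMulVec, hw]
    simp [sq]
  have hlt : 1 / (m : ℝ) ^ 2 < 1 := by
    rw [div_lt_one (by positivity)]; nlinarith
  set b : ℝ := (ε - 1 / (m : ℝ) ^ 2) / (1 - 1 / (m : ℝ) ^ 2) with hb
  have hb0 : 0 ≤ b := div_nonneg (by linarith) (by linarith)
  have hbe : b * (1 - 1 / (m : ℝ) ^ 2) = ε - 1 / (m : ℝ) ^ 2 :=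
    div_mul_cancel₀ _ (by linarith)
  refine ⟨fun i => R i + (b : ℂ) • (1 - R i), R, ?_, hR, ?_⟩
  · intro i
    exact (hR i).add ((hQ i).smul (by exact_mod_cast hb0))
  · intro i j
    rw [add_mul, trace_add, smul_mul_assoc, trace_smul, sub_mul, trace_sub, one_mul, htR, htRR, hA,
      hu]
    by_cases hij : i = j
    · simp [hij]
    · simp only [hij, if_false, smul_eq_mul]
      have : ε = (-1 / (m:ℝ)) ^ 2 + b * (1 - (-1 / (m:ℝ)) ^ 2) := by
        have h6 : (-1 / (m:ℝ)) ^ 2 = 1 / (m : ℝ) ^ 2 := by ring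
        rw [h6, hbe]; ring
      exact_mod_cast this

open Matrix Finset in
theorem aux_full {n : ℕ} (A : Matrix (Fin n) (Fin n) ℝ) (hA : ∀ i j, 0 ≤ A i j) :
    ∃ (E : Fin n → Matrix (Fin n) (Fin n) ℂ) (F : Fin n → Matrix (Fin n) (Fin n) ℂ),
      (∀ i, (E i).PosSemidef) ∧ (∀ j, (F j).PosSemidef) ∧
      ∀ i j, (A i j : ℂ) = ((E i) * (F j)).trace := by
  refine ⟨fun i => diagonal (fun k => if k = i then 1 else 0),
    fun j => diagonal (fun k => (A k j : ℂ)), ?_, ?_, ?_⟩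
  · intro i
    rw [posSemidef_diagonal_iff]
    intro k; split_ifs <;> simp
  · intro j
    rw [posSemidef_diagonal_iff]
    intro k; exact_mod_cast hA k j
  · intro i j
    simp [trace_diagonal]

/-- For `n ≥ 3` and `ε ≥ 0`, the matrix with ones on the diagonal and `ε` off the
diagonal has full PSD-rank `n` if and only if `ε < 1/(n-1)²`. -/
theorem prank_eq_full_iff {n : ℕ} (hn : 3 ≤ n) (ε : ℝ) (hε : 0 ≤ ε)
    (A : Matrix (Fin n) (Fin n) ℝ)
    (hA : ∀ i j, A i j = if i = j then 1 else ε) :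
    prank A = n ↔ ε < 1 / ((n : ℝ) - 1) ^ 2 := by
  have hfull := aux_full A (fun i j => by rw [hA]; split_ifs <;> [exact zero_le_one; exact hε])
  have hle : prank A ≤ n := Nat.sInf_le hfull
  constructor
  · intro h
    by_contra hlt
    push Not at hlt
    obtain ⟨m, rfl⟩ : ∃ m, n = m + 1 := ⟨n - 1, by omega⟩
    have : prank A ≤ m := Nat.sInf_le (aux_upper (by omega) ε (by simpa using hlt) A hA)
    omega
  · intro h
    by_contra hne
    have hlt : prank A + 1 ≤ n := by omega
    obtain ⟨E, F, hE, hF, hEF⟩ := Nat.sInf_mem (s := {r : ℕ |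
      ∃ (E : Fin n → Matrix (Fin r) (Fin r) ℂ) (F : Fin n → Matrix (Fin r) (Fin r) ℂ),
      (∀ i, (E i).PosSemidef) ∧ (∀ j, (F j).PosSemidef) ∧
      ∀ i j, (A i j : ℂ) = ((E i) * (F j)).trace}) ⟨n, hfull⟩
    have h1 := aux_lower_s15 A (fun i => by simp [hA]) E F hE hF hEF
    change (n : ℝ) ^ 2 ≤ (prank A : ℝ) * _ at h1
    have h2 : ∑ i, ∑ j, A i j = n * (1 + (n - 1) * ε) := by
      have : ∀ i j, A i j = ε + if i = j then 1 - ε else 0 := by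
        intro i j; rw [hA]; split_ifs <;> ring
      simp only [this, Finset.sum_add_distrib, Finset.sum_ite_eq, Finset.mem_univ, if_true,
        Finset.sum_const, Finset.card_univ, Fintype.card_fin, nsmul_eq_mul]
      ring
    rw [h2] at h1
    have hn' : (3 : ℝ) ≤ n := by exact_mod_cast hn
    have hlt' : (prank A : ℝ) ≤ n - 1 := by
      have : (prank A : ℝ) + 1 ≤ n := by exact_mod_cast hlt
      linarith
    have hpos : 0 ≤ 1 + ((n : ℝ) - 1) * ε := by
      have := mul_nonneg (show (0:ℝ) ≤ n - 1 by linarith) hε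
      linarith
    have h3 : (n : ℝ) ^ 2 ≤ (n - 1) * (n * (1 + (n - 1) * ε)) :=
      h1.trans (mul_le_mul_of_nonneg_right hlt' (mul_nonneg (by linarith) hpos))
    have h4 : (n : ℝ) ≤ (n - 1) * (1 + (n - 1) * ε) := by
      refine le_of_mul_le_mul_left (a := (n : ℝ)) ?_ (by linarith)
      nlinarith
    have hp2 : (0:ℝ) < ((n : ℝ) - 1) ^ 2 := by
      have : (0:ℝ) < (n : ℝ) - 1 := by linarith
      positivity
    rw [lt_div_iff₀ hp2] at h
    nlinarith
end

section
/- Let m ≥ 2 divide n, let B be the m×m matrix with B(i,i) = 1 for all i and B(i,j) = 1/(m−1)² for all i ≠ j, and let A = I_{n/m} ⊗ B (the Kronecker product of the (n/m)×(n/m) identity matrix with B). Then prank(A) ≤ n − n/m. -/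
open scoped ComplexOrder

theorem prank_le_of_vec {α γ : Type*} [Fintype α] [Fintype γ] (A : Matrix α α ℝ)
    (w : α → γ → ℝ) (h : ∀ i j, A i j = (∑ s, w i s * w j s) ^ 2) :
    prank A ≤ Fintype.card γ := by
  classical
  apply Nat.sInf_le
  let e := (Fintype.equivFin γ).symm
  let u : α → Fin (Fintype.card γ) → ℂ := fun i s => (w i (e s) : ℂ)
  refine ⟨fun i => Matrix.vecMulVec (u i) (star (u i)),
    fun i => Matrix.vecMulVec (u i) (star (u i)),
    fun i => Matrix.posSemidef_vecMulVec_self_star _,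
    fun i => Matrix.posSemidef_vecMulVec_self_star _, fun i j => ?_⟩
  have h1 : ∑ s, w i s * w j s = ∑ s, w i (e s) * w j (e s) :=
    (Equiv.sum_comp e (fun s => w i s * w j s)).symm
  rw [h, h1]
  simp only [Matrix.trace, Matrix.diag, Matrix.mul_apply, Matrix.vecMulVec_apply, u, Pi.star_apply,
    Complex.star_def, Complex.conj_ofReal]
  push_cast
  rw [sq, Finset.sum_mul_sum]
  refine Finset.sum_congr rfl fun x _ => Finset.sum_congr rfl fun y _ => ?_
  ring

theorem exists_simplex (k : ℕ) (hk : 1 ≤ k) : ∃ v : Fin (k + 1) → Fin k → ℝ,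
    ∀ i j, ∑ s, v i s * v j s = if i = j then 1 else - (1 / (k : ℝ)) := by
  have hk0 : (0 : ℝ) < k := by exact_mod_cast hk
  obtain ⟨c, hc⟩ : ∃ c : ℝ, c ^ 2 = 1 / k := ⟨√(1 / k), Real.sq_sqrt (by positivity)⟩
  obtain ⟨a, ha⟩ : ∃ a : ℝ, a ^ 2 = 1 + 1 / k := ⟨√(1 + 1 / k), Real.sq_sqrt (by positivity)⟩
  obtain ⟨b, hb⟩ : ∃ b : ℝ, a + k * b = - c := ⟨(- c - a) / k, by field_simp; ring⟩
  have hb2 : 2 * a * b + k * b ^ 2 = - (1 / k) := by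
    have h2 : (a + k * b) ^ 2 = 1 / k := by rw [hb, neg_sq, hc]
    have h3 : k * (2 * a * b + k * b ^ 2) = -1 := by linear_combination h2 - ha
    field_simp
    linear_combination h3
  have hkc : k * c ^ 2 = 1 := by rw [hc]; field_simp
  refine ⟨Fin.lastCases (fun _ => c) (fun i s => (if i = s then a else 0) + b), fun i j => ?_⟩
  induction i using Fin.lastCases with
  | last =>
    induction j using Fin.lastCases with
    | last => simp; linear_combination hkc
    | cast j =>
      simp [← Finset.mul_sum, Finset.sum_add_distrib, (Fin.castSucc_lt_last j).ne']
      rw [hb, inv_eq_one_div, ← hc]; ring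
  | cast i =>
    induction j using Fin.lastCases with
    | last =>
      simp [← Finset.sum_mul, Finset.sum_add_distrib, (Fin.castSucc_lt_last i).ne]
      rw [hb, inv_eq_one_div, ← hc]; ring
    | cast j =>
      simp only [Fin.lastCases_castSucc, Fin.castSucc_inj]
      have : ∀ s : Fin k, ((if i = s then a else 0) + b) * ((if j = s then a else 0) + b)
        = (if i = s then (if j = s then a ^ 2 else 0) else 0) + (if i = s then a * b else 0)
          + (if j = s then a * b else 0) + b ^ 2 := by
        intro s; split_ifs <;> ring
      simp only [this, Finset.sum_add_distrib, Finset.sum_ite_eq, Finset.mem_univ, if_true,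
        Finset.sum_const, Finset.card_univ, Fintype.card_fin, nsmul_eq_mul]
      simp only [eq_comm (a := j)]
      split_ifs
      · linear_combination ha + hb2
      · linear_combination hb2

open Kronecker in
/-- If `m ≥ 2` divides `n` and `B` is the `m × m` matrix with ones on the diagonal
and `1/(m-1)²` off the diagonal, then `prank (I_{n/m} ⊗ B) ≤ n - n/m`. -/
theorem prank_kronecker_identity_approx {m n : ℕ} (hm : 2 ≤ m) (hdvd : m ∣ n)
    (B : Matrix (Fin m) (Fin m) ℝ)
    (hB : ∀ i j, B i j = if i = j then 1 else 1 / ((m : ℝ) - 1) ^ 2) :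
    prank ((1 : Matrix (Fin (n / m)) (Fin (n / m)) ℝ) ⊗ₖ B) ≤ n - n / m := by
  obtain ⟨k, rfl⟩ : ∃ k, m = k + 1 := ⟨m - 1, by omega⟩
  obtain ⟨v, hv⟩ := exists_simplex k (by omega)
  have hcard : Fintype.card (Fin (n / (k + 1)) × Fin k) = n - n / (k + 1) := by
    obtain ⟨N, rfl⟩ := hdvd
    rw [Nat.mul_div_cancel_left _ (by omega : 0 < k + 1)]
    simp only [Fintype.card_prod, Fintype.card_fin]
    rw [add_mul, one_mul, Nat.add_sub_cancel, mul_comm]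
  rw [← hcard]
  refine prank_le_of_vec _ (fun p q => if p.1 = q.1 then v p.2 q.2 else 0) ?_
  rintro ⟨p, i⟩ ⟨q, j⟩
  rw [Matrix.kronecker_apply, hB, Fintype.sum_prod_type]
  by_cases hpq : p = q
  · subst hpq
    have : ∀ x, (∑ y, (if p = x then v i y else 0) * (if p = x then v j y else 0))
        = if p = x then ∑ y, v i y * v j y else 0 := by
      intro x; split_ifs <;> simp
    simp only [this, Finset.sum_ite_eq, Finset.mem_univ, if_true, hv, Matrix.one_apply_eq, one_mul]
    split_ifs
    · simp
    · push_cast; rw [add_sub_cancel_right]; ring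
  · rw [Matrix.one_apply_ne hpq, zero_mul, eq_comm, sq_eq_zero_iff]
    refine Finset.sum_eq_zero fun x _ => Finset.sum_eq_zero fun y _ => ?_
    dsimp only
    split_ifs with h1 h2
    · exact absurd (h1.trans h2.symm) hpq
    all_goals simp
end

section
/- Let c ≥ 0 be a real number and let M_c be the n×n matrix with M_c(i,i) = c for all i and M_c(i,j) = 1 for all i ≠ j. If c > 2, then rprank(M_c) ≤ 2·⌈c⌉·⌈√n⌉. If 0 ≤ c ≤ 2, then rprank(M_c) ≤ ⌈√(2n)⌉ + 1. -/
open scoped ComplexOrder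

open Matrix in
lemma rprank_le_card {α β ι : Type*} [Fintype α] [Fintype β] [Fintype ι]
    (A : Matrix α β ℝ) (E : α → Matrix ι ι ℝ) (F : β → Matrix ι ι ℝ)
    (hE : ∀ i, (E i).PosSemidef) (hF : ∀ j, (F j).PosSemidef)
    (h : ∀ i j, A i j = ((E i) * (F j)).trace) : rprank A ≤ Fintype.card ι := by
  classical
  apply Nat.sInf_le
  let e := (Fintype.equivFin ι).symm
  refine ⟨fun i => (E i).submatrix e e, fun j => (F j).submatrix e e,
    fun i => (hE i).submatrix e, fun j => (hF j).submatrix e, fun i j => ?_⟩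
  rw [h, Matrix.submatrix_mul_equiv]
  simp only [Matrix.trace, Matrix.diag, Matrix.submatrix_apply]
  exact (Equiv.sum_comp e (fun x => (E i * F j) x x)).symm

lemma rprank_trivial {n : ℕ} (M : Matrix (Fin n) (Fin n) ℝ) (h : ∀ i j, 0 ≤ M i j) :
    rprank M ≤ n := by
  have := rprank_le_card (ι := Fin n) M (fun i => Matrix.diagonal (Pi.single i 1))
    (fun j => Matrix.diagonal (fun i => M i j))
    (fun i => Matrix.PosSemidef.diagonal (by
      intro k; by_cases hk : k = i
      · subst hk; simp
      · simp [hk]))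
    (fun j => Matrix.PosSemidef.diagonal (fun i => h i j))
    (fun i j => by simp [Matrix.diagonal_mul_diagonal, Matrix.trace_diagonal, Pi.single_apply])
  simpa using this

lemma rprank_design {n : ℕ} {ι : Type*} [Fintype ι] [DecidableEq ι] (c : ℝ) (hc : 0 ≤ c)
    (d : ℕ) (hd : 2 ≤ d) (hcd : c ≤ d)
    (M : Matrix (Fin n) (Fin n) ℝ)
    (hM : ∀ i j, M i j = if i = j then c else 1)
    (e : Fin n → Finset ι) (he : ∀ i, (e i).card = d)
    (hi : ∀ i j, i ≠ j → (e i ∩ e j).card ≤ 1) : rprank M ≤ Fintype.card ι := by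
  have hd' : (2:ℝ) ≤ d := by exact_mod_cast hd
  obtain ⟨t, ht⟩ : ∃ t : ℝ, t * (d - 1) = c - 1 :=
    ⟨(c-1)/(d-1), div_mul_cancel₀ _ (by linarith)⟩
  have ht1 : t ≤ 1 := by
    by_contra hh
    push Not at hh
    nlinarith
  let v : Fin n → ι → ℝ := fun i x => if x ∈ e i then 1 else 0
  let F : Fin n → Matrix ι ι ℝ := fun j =>
    (d:ℝ)⁻¹ • (1 - t • Matrix.diagonal (v j) + t • Matrix.vecMulVec (v j) (v j))
  have hquad : ∀ j (x : ι → ℝ), x ⬝ᵥ (F j).mulVec x =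
      (d:ℝ)⁻¹ * (∑ k, x k ^ 2 - t * ∑ k ∈ e j, x k ^ 2 + t * (∑ k ∈ e j, x k) ^ 2) := by
    intro j x
    have h1 : x ⬝ᵥ (Matrix.diagonal (v j)).mulVec x = ∑ k ∈ e j, x k ^ 2 := by
      simp [dotProduct, Matrix.mulVec_diagonal, v, Finset.sum_ite_mem, pow_two]
    have h2 : v j ⬝ᵥ x = ∑ k ∈ e j, x k := by
      simp [dotProduct, v]
    have h3 : x ⬝ᵥ v j = ∑ k ∈ e j, x k := by
      rw [dotProduct_comm, h2]
    have h4 : x ⬝ᵥ x = ∑ k, x k ^ 2 := by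
      simp [dotProduct, pow_two]
    simp only [F, Matrix.smul_mulVec, Matrix.add_mulVec, Matrix.sub_mulVec, Matrix.one_mulVec,
      dotProduct_smul, dotProduct_add, dotProduct_sub, Matrix.vecMulVec_mulVec, h1, h2, h3, h4,
      smul_eq_mul, MulOpposite.smul_eq_mul_unop, MulOpposite.unop_op, op_smul_eq_smul]
    ring
  have hFp : ∀ j, (F j).PosSemidef := by
    intro j
    refine Matrix.PosSemidef.of_dotProduct_mulVec_nonneg ?_ ?_
    · ext a b
      simp only [F, Matrix.conjTranspose_apply, Matrix.smul_apply, Matrix.add_apply,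
        Matrix.sub_apply, Matrix.vecMulVec_apply, Matrix.one_apply, Matrix.diagonal_apply,
        star_trivial, smul_eq_mul]
      by_cases hab : a = b
      · subst hab; rfl
      · simp [hab, Ne.symm hab]; left; left; ring
    · intro x
      rw [star_trivial, hquad]
      apply mul_nonneg (by positivity)
      have h1 : ∑ k ∈ e j, x k ^ 2 ≤ ∑ k, x k ^ 2 :=
        Finset.sum_le_univ_sum_of_nonneg (fun k => sq_nonneg _)
      have h2 : (∑ k ∈ e j, x k) ^ 2 ≤ d * ∑ k ∈ e j, x k ^ 2 := by
        rw [← he j]; exact sq_sum_le_card_mul_sum_sq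
      have h3 : 0 ≤ ∑ k ∈ e j, x k ^ 2 := Finset.sum_nonneg (fun k _ => sq_nonneg _)
      have h4 : 0 ≤ (∑ k ∈ e j, x k) ^ 2 := sq_nonneg _
      rcases le_total 0 t with h0 | h0
      · nlinarith
      · nlinarith
  refine rprank_le_card M (fun i => Matrix.vecMulVec (v i) (v i)) F (fun i => ?_) hFp ?_
  · simpa using Matrix.posSemidef_vecMulVec_self_star (v i)
  · intro i j
    have hd0 : (d:ℝ) ≠ 0 := by linarith
    rw [Matrix.trace_mul_comm, Matrix.mul_vecMulVec, Matrix.trace_vecMulVec, dotProduct_comm,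
      hquad]
    have h1 : ∑ k, v i k ^ 2 = d := by
      simp [v, he]
    have h2 : ∑ k ∈ e j, v i k ^ 2 = ((e i ∩ e j).card : ℝ) := by
      simp [v, Finset.inter_comm, Finset.filter_mem_eq_inter]
    have h3 : ∑ k ∈ e j, v i k = ((e i ∩ e j).card : ℝ) := by
      simp [v, Finset.inter_comm, Finset.filter_mem_eq_inter]
    rw [h1, h2, h3, hM]
    split_ifs with hij
    · subst hij
      rw [Finset.inter_self, he]
      field_simp
      linear_combination -ht
    · have := hi i j hij
      interval_cases hk : (e i ∩ e j).card <;> simp [hd0]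

theorem rprank_Mc_upper_bound {n : ℕ} (c : ℝ) (hc : 0 ≤ c)
    (M : Matrix (Fin n) (Fin n) ℝ)
    (hM : ∀ i j, M i j = if i = j then c else 1) :
    (2 < c → rprank M ≤ 2 * ⌈c⌉₊ * ⌈Real.sqrt n⌉₊) ∧
    (c ≤ 2 → rprank M ≤ ⌈Real.sqrt (2 * n)⌉₊ + 1) := by
  constructor
  · intro h2
    have hd : 2 < ⌈c⌉₊ := Nat.lt_ceil.mpr (by exact_mod_cast h2)
    have hcd := Nat.le_ceil c
    generalize ⌈c⌉₊ = d at *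
    have hk : n ≤ ⌈Real.sqrt n⌉₊ ^ 2 := by
      have := (Real.sqrt_le_left (by positivity)).mp (Nat.le_ceil (Real.sqrt n))
      exact_mod_cast this
    generalize ⌈Real.sqrt n⌉₊ = k at *
    rcases le_or_gt k d with hkd | hkd
    · refine (rprank_trivial M ?_).trans ?_
      · intro i j; rw [hM]; split_ifs <;> linarith
      · nlinarith
    · obtain ⟨p, hp, hkp, hp2⟩ := Nat.exists_prime_lt_and_le_two_mul k (by omega)
      haveI : Fact p.Prime := ⟨hp⟩
      have hcard : Fintype.card (Fin n) ≤ Fintype.card (ZMod p × ZMod p) := by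
        simp only [Fintype.card_fin, Fintype.card_prod, ZMod.card]; nlinarith
      obtain ⟨g⟩ := Function.Embedding.nonempty_of_card_le hcard
      have hmem : ∀ i (z : Fin d × ZMod p), z ∈ Finset.univ.image (fun x : Fin d =>
        (x, (g i).1 * ((x : ℕ) : ZMod p) + (g i).2)) ↔
          z.2 = (g i).1 * ((z.1 : ℕ) : ZMod p) + (g i).2 := by
        rintro i ⟨x, y⟩
        simp [eq_comm]
      have := rprank_design (ι := Fin d × ZMod p) c hc d hd.le hcd M hM
        (fun i => Finset.univ.image (fun x : Fin d =>
          (x, (g i).1 * ((x : ℕ) : ZMod p) + (g i).2))) (fun i => by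
            rw [Finset.card_image_of_injective _ (fun a b h => (Prod.ext_iff.mp h).1)]
            simp) (fun i j hij => by
            rw [Finset.card_le_one]
            rintro ⟨x, y⟩ hx ⟨x', y'⟩ hx'
            simp only [Finset.mem_inter, hmem] at hx hx'
            obtain ⟨a1, a2⟩ := hx
            obtain ⟨b1, b2⟩ := hx'
            have hne : (g i).1 ≠ (g j).1 := by
              intro h
              apply hij
              apply g.injective
              refine Prod.ext h ?_
              rw [h] at a1
              exact add_left_cancel (a1.symm.trans a2)
            have hm : ((g i).1 - (g j).1) * (((x : ℕ) : ZMod p) - ((x' : ℕ) : ZMod p)) = 0 := by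
              linear_combination a2 - a1 - b2 + b1
            have hx : ((x : ℕ) : ZMod p) = ((x' : ℕ) : ZMod p) := by
              rcases mul_eq_zero.mp hm with h | h
              · exact absurd (sub_eq_zero.mp h) hne
              · exact sub_eq_zero.mp h
            have hxx : x = x' := by
              rw [ZMod.natCast_eq_natCast_iff'] at hx
              rw [Nat.mod_eq_of_lt (by omega), Nat.mod_eq_of_lt (by omega)] at hx
              exact Fin.ext hx
            subst hxx
            rw [a1, b1])
      refine this.trans ?_
      simp only [Fintype.card_fin, Fintype.card_prod, ZMod.card]
      nlinarith
  · intro h2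
    have hk : 2 * n ≤ ⌈Real.sqrt (2 * n)⌉₊ ^ 2 := by
      have := (Real.sqrt_le_left (by positivity)).mp (Nat.le_ceil (Real.sqrt (2 * n)))
      exact_mod_cast this
    generalize ⌈Real.sqrt (2 * n)⌉₊ = k at *
    have hcard : Fintype.card (Fin n) ≤
        Fintype.card (Finset.powersetCard 2 (Finset.univ : Finset (Fin (k+1)))) := by
      simp only [Fintype.card_fin, Fintype.card_coe, Finset.card_powersetCard, Finset.card_univ]
      rw [Nat.choose_two_right, Nat.le_div_iff_mul_le (by norm_num)]
      simp only [Nat.add_sub_cancel]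
      nlinarith
    obtain ⟨g⟩ := Function.Embedding.nonempty_of_card_le hcard
    have hc2 : ∀ i, (g i).1.card = 2 := fun i => (Finset.mem_powersetCard.mp (g i).2).2
    have := rprank_design (ι := Fin (k+1)) c hc 2 le_rfl (by exact_mod_cast h2) M hM
      (fun i => (g i).1) hc2 (fun i j hij => by
        by_contra hh
        push Not at hh
        apply hij
        apply g.injective
        apply Subtype.ext
        have e1 := Finset.eq_of_subset_of_card_le
          (Finset.inter_subset_left (s₁ := (g i).1) (s₂ := (g j).1)) (by rw [hc2]; omega)
        have e2 := Finset.eq_of_subset_of_card_le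
          (Finset.inter_subset_right (s₁ := (g i).1) (s₂ := (g j).1)) (by rw [hc2]; omega)
        exact e1.symm.trans e2)
    simpa using this
end

section
/- Let n be a positive integer, N = 2^n, and let IP_n be the N×N matrix whose rows and columns are indexed by strings x, y ∈ {0,1}^n, with IP_n(x,y) = ∑_{i=1}^n x_i y_i mod 2 (viewed as 0 or 1). If n is even, then rprank(IP_n) ≤ 2·√N = 2^{n/2+1}; if n is odd, then rprank(IP_n) ≤ (3/2)·√2·√N = 3·2^{(n−1)/2}. -/
open scoped ComplexOrder

theorem rprank_IP_split (m l : ℕ)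
    (IP : Matrix (Fin (m + l) → ZMod 2) (Fin (m + l) → ZMod 2) ℝ)
    (hIP : ∀ x y, IP x y = ((∑ i, x i * y i : ZMod 2).val : ℝ)) :
    rprank IP ≤ 2 ^ m + 2 ^ l := by
  have hc : Fintype.card ((Fin m → ZMod 2) ⊕ (Fin l → ZMod 2)) = 2 ^ m + 2 ^ l := by
    simp [ZMod.card]
  let e := Fintype.equivFinOfCardEq hc
  let u : (Fin (m + l) → ZMod 2) → ((Fin m → ZMod 2) ⊕ (Fin l → ZMod 2)) → ℝ := fun x =>
    Sum.elim (Pi.single (fun i => x (Fin.castAdd l i)) 1)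
      (Pi.single (fun i => x (Fin.natAdd m i)) (-1))
  let v : (Fin (m + l) → ZMod 2) → ((Fin m → ZMod 2) ⊕ (Fin l → ZMod 2)) → ℝ := fun y =>
    Sum.elim (fun z => ((∑ i, z i * y (Fin.castAdd l i) : ZMod 2).val : ℝ))
      (fun z => ((∑ i, z i * y (Fin.natAdd m i) : ZMod 2).val : ℝ))
  apply Nat.sInf_le
  refine ⟨fun x => Matrix.vecMulVec (u x ∘ e.symm) (u x ∘ e.symm),
    fun y => Matrix.vecMulVec (v y ∘ e.symm) (v y ∘ e.symm), ?_, ?_, ?_⟩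
  · intro x
    simpa using Matrix.posSemidef_vecMulVec_self_star (u x ∘ e.symm)
  · intro x
    simpa using Matrix.posSemidef_vecMulVec_self_star (v x ∘ e.symm)
  · intro x y
    have h1 : (u x ∘ e.symm) ⬝ᵥ (v y ∘ e.symm) = u x ⬝ᵥ v y := by
      simp only [dotProduct, Function.comp]
      exact Equiv.sum_comp e.symm (fun i => u x i * v y i)
    have h2 : u x ⬝ᵥ v y =
        ((∑ i, x (Fin.castAdd l i) * y (Fin.castAdd l i) : ZMod 2).val : ℝ)
        - ((∑ i, x (Fin.natAdd m i) * y (Fin.natAdd m i) : ZMod 2).val : ℝ) := by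
      simp [u, v, dotProduct, Fintype.sum_sum_type, Pi.single_apply, sub_eq_add_neg]
    have h3 : (Matrix.vecMulVec (u x ∘ e.symm) (u x ∘ e.symm) *
        Matrix.vecMulVec (v y ∘ e.symm) (v y ∘ e.symm)).trace = (u x ⬝ᵥ v y) ^ 2 := by
      rw [Matrix.vecMulVec_mul_vecMulVec, h1, Matrix.trace_vecMulVec, dotProduct_smul, h1]
      simp [sq]
    have key : ∀ a b : ZMod 2, (((a + b : ZMod 2).val : ℕ) : ℝ) =
        ((a.val : ℝ) - (b.val : ℝ)) ^ 2 := by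
      intro a b
      have : (((a + b : ZMod 2).val : ℕ) : ℤ) = ((a.val : ℤ) - (b.val : ℤ)) ^ 2 := by
        revert a b; decide
      exact_mod_cast this
    rw [h3, h2, hIP, Fin.sum_univ_add, key]

/-- Real PSD-rank upper bounds for the inner product matrix `IP_n` of size `N = 2^n`:
if `n` is even then `rprank IP_n ≤ 2^(n/2+1) = 2√N`, and if `n` is odd then
`rprank IP_n ≤ 3·2^((n-1)/2) = (3/2)√2·√N`. -/
theorem rprank_inner_product_upper_bound {n : ℕ} (hn : 0 < n)
    (IP : Matrix (Fin n → ZMod 2) (Fin n → ZMod 2) ℝ)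
    (hIP : ∀ x y, IP x y = ((∑ i, x i * y i : ZMod 2).val : ℝ)) :
    (Even n → rprank IP ≤ 2 ^ (n / 2 + 1)) ∧
    (Odd n → rprank IP ≤ 3 * 2 ^ ((n - 1) / 2)) := by
  constructor
  · rintro ⟨k, rfl⟩
    have h := rprank_IP_split k k IP hIP
    have e : (k + k) / 2 = k := by omega
    rw [e, pow_succ]
    omega
  · rintro ⟨k, rfl⟩
    have e : (2 * k + 1 - 1) / 2 = k := by omega
    rw [e]
    have aux : ∀ n (_ : n = k + (k + 1))
        (IP : Matrix (Fin n → ZMod 2) (Fin n → ZMod 2) ℝ)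
        (_ : ∀ x y, IP x y = ((∑ i, x i * y i : ZMod 2).val : ℝ)),
        rprank IP ≤ 2 ^ k + 2 ^ (k + 1) := by
      rintro n rfl IP hIP
      exact rprank_IP_split k (k + 1) IP hIP
    have h := aux (2 * k + 1) (by omega) IP hIP
    rw [pow_succ] at h
    omega
end
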